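/- If the random rotation number ρ_{τ,ε} is irrational, then the Lyapunov exponent is strictly negative: λ_{τ,ε} < 0, i.e. for P-almost every ω and m_{τ,ε}-almost every x, lim_{n→∞} (1/n) Σ_{k=0}^{n−1} log F'(φ(k,ω)(x)) < 0. -/

import Mathlib

open MeasureTheory Real Filter Set Function

noncomputable section

lemma sin2_periodic : Function.Periodic (fun x : ℝ => Real.sin (2 * π * x)) 1 := by
  intro x
  simp only [mul_add, mul_one]
  exact Real.sin_add_two_pi _

lemma cos2_periodic : Function.Periodic (fun x : ℝ => Real.cos (2 * π * x)) 1 := by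
  intro x
  simp only [mul_add, mul_one]
  exact Real.cos_add_two_pi _

/-- `sin (2πx)` viewed as a function on the circle `ℝ/ℤ`. -/
def sinA : AddCircle (1:ℝ) → ℝ := sin2_periodic.lift

/-- `cos (2πx)` viewed as a function on the circle `ℝ/ℤ`. -/
def cosA : AddCircle (1:ℝ) → ℝ := cos2_periodic.lift

/-- The noisy Arnol'd circle map `F_w(x) = x + τ + σ w − ε sin (2πx)  (mod 1)`. -/
def Fmap (τ ε σ w : ℝ) : AddCircle (1:ℝ) → AddCircle (1:ℝ) :=
  fun x => x + (↑(τ + σ * w - ε * sinA x) : AddCircle (1:ℝ))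

/-- The common derivative `F'(x) = 1 − 2πε cos(2πx)` of the maps `F_w`. -/
def Fder (ε : ℝ) (x : AddCircle (1:ℝ)) : ℝ := 1 - 2 * π * ε * cosA x

/-- The lift `G_w(x) = x + τ + σ w − ε sin (2πx)`. -/
def Gmap (τ ε σ w : ℝ) (x : ℝ) : ℝ :=
  x + τ + σ * w - ε * Real.sin (2 * π * x)

/-- Iterated lifts `G^n_ω = G_{ω_{n−1}} ∘ ⋯ ∘ G_{ω_0}`. -/
def Gn (τ ε σ : ℝ) (ω : ℤ → ℝ) : ℕ → ℝ → ℝ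
  | 0 => id
  | n + 1 => Gmap τ ε σ (ω n) ∘ Gn τ ε σ ω n

/-- The uniform probability measure on `I = [−1/2, 1/2]`. -/
def nuI : Measure ℝ := volume.restrict (Icc (-(1/2) : ℝ) (1/2))

/-- A Borel probability measure `m` on the circle is stationary for the noisy circle-map
family when `∫_I (F_w)_* m dν(w) = m`. -/
def IsStationaryNoisy (τ ε σ : ℝ) (m : Measure (AddCircle (1:ℝ))) : Prop :=
  nuI.bind (fun w => m.map (Fmap τ ε σ w)) = m

/-- The forward random iterates `φ(0,ω) = id`, `φ(n,ω) = F_{ω_{n−1}} ∘ ⋯ ∘ F_{ω_0}`. -/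
def phiN (τ ε σ : ℝ) (ω : ℤ → ℝ) : ℕ → AddCircle (1:ℝ) → AddCircle (1:ℝ)
  | 0 => id
  | n + 1 => Fmap τ ε σ (ω n) ∘ phiN τ ε σ ω n

/-- `P` is the two-sided infinite product measure `ν^⊗ℤ` on `Ω = I^ℤ`, characterized by
its finite-dimensional marginals. -/
def IsProductNuZ (P : Measure (ℤ → ℝ)) : Prop :=
  IsProbabilityMeasure P ∧
    ∀ s : Finset ℤ, P.map (fun ω (i : s) => ω i) = Measure.pi (fun _ : s => nuI)

/-! ### The lifts on the real line -/

lemma Gmap_eq_add (τ ε σ w x : ℝ) : Gmap τ ε σ w x = Gmap τ ε σ 0 x + σ * w := by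
  simp only [Gmap]; ring

lemma hasDerivAt_Gmap (τ ε σ w x : ℝ) :
    HasDerivAt (Gmap τ ε σ w) (1 - 2 * π * ε * Real.cos (2 * π * x)) x := by
  have h1 : HasDerivAt (fun x : ℝ => 2 * π * x) (2 * π) x := by
    simpa using (hasDerivAt_id x).const_mul (2 * π)
  have h2 := ((((hasDerivAt_id x).add_const τ).add_const (σ * w)).sub (h1.sin.const_mul ε))
  refine h2.congr_deriv ?_
  ring

lemma one_sub_le_one_sub_mul_cos {ε : ℝ} (hε : 0 < ε) (t : ℝ) :
    1 - 2 * π * ε ≤ 1 - 2 * π * ε * Real.cos t := by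
  have : 0 < 2 * π * ε := by positivity
  nlinarith [Real.cos_le_one t]

lemma one_sub_mul_cos_le_two {ε : ℝ} (hε : 0 < ε) (hεπ : 2 * π * ε < 1) (t : ℝ) :
    1 - 2 * π * ε * Real.cos t ≤ 2 := by
  have : 0 < 2 * π * ε := by positivity
  nlinarith [Real.neg_one_le_cos t]

section Lift

variable {τ ε σ : ℝ} (hε : 0 < ε) (hεπ : 2 * π * ε < 1)
include hε

lemma mul_sub_le_Gmap_sub (w : ℝ) {x y : ℝ} (hxy : x ≤ y) :
    (1 - 2 * π * ε) * (y - x) ≤ Gmap τ ε σ w y - Gmap τ ε σ w x :=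
  mul_sub_le_image_sub_of_le_deriv (fun x => (hasDerivAt_Gmap τ ε σ w x).differentiableAt)
    (fun x => by
      rw [(hasDerivAt_Gmap τ ε σ w x).deriv]; exact one_sub_le_one_sub_mul_cos hε _) hxy

include hεπ

lemma Gmap_sub_le_two_mul_sub (w : ℝ) {x y : ℝ} (hxy : x ≤ y) :
    Gmap τ ε σ w y - Gmap τ ε σ w x ≤ 2 * (y - x) :=
  image_sub_le_mul_sub_of_deriv_le (fun x => (hasDerivAt_Gmap τ ε σ w x).differentiableAt)
    (fun x => by
      rw [(hasDerivAt_Gmap τ ε σ w x).deriv]; exact one_sub_mul_cos_le_two hε hεπ _) hxy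

lemma strictMono_Gmap (w : ℝ) : StrictMono (Gmap τ ε σ w) := by
  intro x y hxy
  have := mul_sub_le_Gmap_sub (τ := τ) (σ := σ) hε w hxy.le
  nlinarith [mul_pos (sub_pos.2 hεπ) (sub_pos.2 hxy)]

/-- The lift `G_w` as a monotone degree one lift. -/
def circleLift (τ ε σ : ℝ) (hε : 0 < ε) (hεπ : 2 * π * ε < 1) (w : ℝ) : CircleDeg1Lift where
  toFun := Gmap τ ε σ w
  monotone' := (strictMono_Gmap hε hεπ w).monotone
  map_add_one' x := by
    have := sin2_periodic x
    simp only [Gmap] at this ⊢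
    rw [this]; ring

lemma circleLift_pow_apply (w : ℝ) (n : ℕ) (x : ℝ) :
    (circleLift τ ε σ hε hεπ w ^ n) x = (Gmap τ ε σ w)^[n] x := by
  rw [CircleDeg1Lift.coe_pow]; rfl

lemma iterate_Gmap_le_Gn (hσ : 0 < σ) {a : ℝ} {ω : ℤ → ℝ} (h : ∀ n : ℕ, a ≤ ω n) (x : ℝ) (n : ℕ) :
    (Gmap τ ε σ a)^[n] x ≤ Gn τ ε σ ω n x := by
  induction n with
  | zero => rfl
  | succ n ih =>
    rw [iterate_succ_apply']
    refine ((strictMono_Gmap hε hεπ a).monotone ih).trans ?_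
    simp only [Gn, comp_apply]
    rw [Gmap_eq_add τ ε σ a, Gmap_eq_add τ ε σ (ω n)]
    have := mul_le_mul_of_nonneg_left (h n) hσ.le
    linarith

lemma Gn_le_iterate_Gmap (hσ : 0 < σ) {b : ℝ} {ω : ℤ → ℝ} (h : ∀ n : ℕ, ω n ≤ b) (x : ℝ) (n : ℕ) :
    Gn τ ε σ ω n x ≤ (Gmap τ ε σ b)^[n] x := by
  induction n with
  | zero => rfl
  | succ n ih =>
    rw [iterate_succ_apply']
    refine le_trans ?_ ((strictMono_Gmap hε hεπ b).monotone ih)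
    simp only [Gn, comp_apply]
    rw [Gmap_eq_add τ ε σ b, Gmap_eq_add τ ε σ (ω n)]
    have := mul_le_mul_of_nonneg_left (h n) hσ.le
    linarith

lemma iterate_Gmap_mono (hσ : 0 < σ) {a b : ℝ} (hab : a ≤ b) (x : ℝ) (n : ℕ) :
    (Gmap τ ε σ a)^[n] x ≤ (Gmap τ ε σ b)^[n] x := by
  induction n with
  | zero => rfl
  | succ n ih =>
    rw [iterate_succ_apply', iterate_succ_apply']
    refine ((strictMono_Gmap hε hεπ a).monotone ih).trans ?_
    rw [Gmap_eq_add τ ε σ a, Gmap_eq_add τ ε σ b]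
    have := mul_le_mul_of_nonneg_left hab hσ.le
    linarith

lemma iterate_Gmap_add_le (hσ : 0 < σ) {a b : ℝ} (hab : a ≤ b) (x : ℝ) {n : ℕ} (hn : n ≠ 0) :
    (Gmap τ ε σ a)^[n] x + σ * (b - a) ≤ (Gmap τ ε σ b)^[n] x := by
  obtain ⟨n, rfl⟩ := Nat.exists_eq_succ_of_ne_zero hn
  rw [iterate_succ_apply', iterate_succ_apply', Gmap_eq_add τ ε σ a, Gmap_eq_add τ ε σ b]
  have := (strictMono_Gmap (τ := τ) (σ := σ) hε hεπ 0).monotone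
    (iterate_Gmap_mono (τ := τ) hε hεπ hσ hab x n)
  linarith

/-- The iterates of `G_w` depend on `w` in a Lipschitz way, uniformly in the initial point. -/
lemma iterate_Gmap_sub_le (hσ : 0 < σ) {a b : ℝ} (hab : a ≤ b) (x : ℝ) (n : ℕ) :
    (Gmap τ ε σ b)^[n] x - (Gmap τ ε σ a)^[n] x ≤ (2 ^ n - 1) * (σ * (b - a)) := by
  induction n with
  | zero => simp
  | succ n ih =>
    rw [iterate_succ_apply', iterate_succ_apply', Gmap_eq_add τ ε σ a, Gmap_eq_add τ ε σ b]
    have := Gmap_sub_le_two_mul_sub (τ := τ) (σ := σ) hε hεπ 0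
      (iterate_Gmap_mono (τ := τ) hε hεπ hσ hab x n)
    rw [pow_succ]
    linarith

open CircleDeg1Lift in
/-- If an irrational number lies between the rotation numbers of the two extreme lifts, then these
rotation numbers differ. -/
lemma translationNumber_lt_of_irrational (hσ : 0 < σ) {a b ρ : ℝ} (hab : a < b)
    (hirr : Irrational ρ) (ha : translationNumber (circleLift τ ε σ hε hεπ a) ≤ ρ)
    (hb : ρ ≤ translationNumber (circleLift τ ε σ hε hεπ b)) :
    translationNumber (circleLift τ ε σ hε hεπ a) <
      translationNumber (circleLift τ ε σ hε hεπ b) := by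
  by_contra! hcon
  have ha' : translationNumber (circleLift τ ε σ hε hεπ a) = ρ := le_antisymm ha (hb.trans hcon)
  have hb' : translationNumber (circleLift τ ε σ hε hεπ b) = ρ := le_antisymm (hcon.trans ha) hb
  set δ := σ * (b - a) with hδ
  have hδpos : 0 < δ := mul_pos hσ (sub_pos.2 hab)
  obtain ⟨n, hn⟩ := exists_nat_one_div_lt hδpos
  obtain ⟨j, k, hk, -, hjk⟩ := Real.exists_int_int_abs_mul_sub_le ρ (n := n + 1) n.succ_pos
  lift k to ℕ using hk.le
  have hk0 : k ≠ 0 := by rintro rfl; simp at hk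
  have hlt : |((k : ℤ) : ℝ) * ρ - j| < δ := by
    refine hjk.trans_lt (lt_of_le_of_lt ?_ hn)
    push_cast
    exact one_div_le_one_div_of_le (by positivity) (by linarith)
  have hne : (k : ℝ) * ρ - j ≠ 0 := by
    have := (hirr.natCast_mul hk0).ne_int j
    exact sub_ne_zero.2 this
  have hgap := fun x => iterate_Gmap_add_le (τ := τ) hε hεπ hσ hab.le x hk0
  have hta : translationNumber (circleLift τ ε σ hε hεπ a ^ k) = k * ρ := by
    rw [translationNumber_pow, ha']
  have htb : translationNumber (circleLift τ ε σ hε hεπ b ^ k) = k * ρ := by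
    rw [translationNumber_pow, hb']
  rw [abs_lt] at hlt
  push_cast at hlt
  rcases lt_or_gt_of_ne hne with h | h
  · by_cases hx : ∀ x, (circleLift τ ε σ hε hεπ a ^ k) x ≤ x + (j - δ)
    · have := translationNumber_le_of_le_add _ hx
      linarith
    · push Not at hx
      obtain ⟨x, hx⟩ := hx
      have h1 : x + (j : ℤ) ≤ (circleLift τ ε σ hε hεπ b ^ k) x := by
        have := hgap x
        rw [circleLift_pow_apply] at hx ⊢
        linarith
      have := le_translationNumber_of_add_int_le _ h1
      linarith
  · by_cases hx : ∀ x, x + (j + δ) ≤ (circleLift τ ε σ hε hεπ b ^ k) x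
    · have := le_translationNumber_of_add_le _ hx
      linarith
    · push Not at hx
      obtain ⟨x, hx⟩ := hx
      have h1 : (circleLift τ ε σ hε hεπ a ^ k) x ≤ x + (j : ℤ) := by
        have := hgap x
        rw [circleLift_pow_apply] at hx ⊢
        linarith
      have := translationNumber_le_of_le_add_int _ h1
      linarith

open CircleDeg1Lift in
lemma exists_iterate_spread (hσ : 0 < σ) {ρ : ℝ} (hirr : Irrational ρ) {ω : ℤ → ℝ}
    (hω : ∀ n : ℕ, ω n ∈ Icc (-(1 / 2) : ℝ) (1 / 2))
    (hρ : Tendsto (fun n : ℕ => (Gn τ ε σ ω n 0 - 0) / n) atTop (nhds ρ)) :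
    ∃ s : ℝ, 0 < s ∧ s < 1 ∧ ∃ n : ℕ, n ≠ 0 ∧ ∀ x,
      (Gmap τ ε σ (-(s / 2)))^[n] x + 1 ≤ (Gmap τ ε σ (s / 2))^[n] x := by
  set A := circleLift τ ε σ hε hεπ (-(1 / 2)) with hA
  set B := circleLift τ ε σ hε hεπ (1 / 2) with hB
  have hAρ : translationNumber A ≤ ρ := by
    refine le_of_tendsto_of_tendsto (tendsto_translationNumber A 0) hρ (.of_forall fun n => ?_)
    simp only [hA, circleLift_pow_apply]
    gcongr
    exact iterate_Gmap_le_Gn hε hεπ hσ (fun n => (hω n).1) _ _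
  have hBρ : ρ ≤ translationNumber B := by
    refine le_of_tendsto_of_tendsto hρ (tendsto_translationNumber B 0) (.of_forall fun n => ?_)
    simp only [hB, circleLift_pow_apply]
    gcongr
    exact Gn_le_iterate_Gmap hε hεπ hσ (fun n => (hω n).2) _ _
  have hlt := translationNumber_lt_of_irrational hε hεπ hσ (by norm_num) hirr hAρ hBρ
  obtain ⟨n, hn⟩ := exists_nat_gt (4 / (translationNumber B - translationNumber A))
  have hn' : 4 < n * (translationNumber B - translationNumber A) :=
    (div_lt_iff₀ (sub_pos.2 hlt)).1 hn
  have hn0 : n ≠ 0 := by rintro rfl; simp at hn'; linarith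
  have hspread : ∀ x, (Gmap τ ε σ (-(1 / 2)))^[n] x + 2 ≤ (Gmap τ ε σ (1 / 2))^[n] x := by
    intro x
    have h1 := map_lt_add_translationNumber_add_one (A ^ n) x
    have h2 : x + translationNumber (B ^ n) - 1 ≤ (B ^ n) x := by
      have h3 := Int.floor_le (translationNumber (B ^ n))
      have h4 := translationNumber_le_ceil_sub (B ^ n) x
      have h5 := Int.ceil_lt_add_one ((B ^ n) x - x)
      linarith
    rw [translationNumber_pow] at h1 h2
    rw [hA, circleLift_pow_apply] at h1
    rw [hB, circleLift_pow_apply] at h2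
    linarith
  set e : ℝ := min (1 / 2) (1 / (2 ^ n * σ)) with he
  have hepos : 0 < e := by positivity
  have he1 : e ≤ 1 / 2 := min_le_left _ _
  have he2 : (2 ^ n - 1) * (σ * (e / 2)) ≤ 1 / 2 := by
    have h1 : e * (2 ^ n * σ) ≤ 1 := (le_div_iff₀ (by positivity)).1 (min_le_right _ _)
    have h2 : 0 < σ * e := by positivity
    nlinarith
  refine ⟨1 - e, by linarith, by linarith, n, hn0, fun x => ?_⟩
  have h1 := iterate_Gmap_sub_le (τ := τ) hε hεπ hσ (a := (1 - e) / 2) (b := 1 / 2) (by linarith) x n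
  have h2 := iterate_Gmap_sub_le (τ := τ) hε hεπ hσ (a := -(1 / 2)) (b := -((1 - e) / 2))
    (by linarith) x n
  rw [show 1 / 2 - (1 - e) / 2 = e / 2 by ring] at h1
  rw [show -((1 - e) / 2) - -(1 / 2) = e / 2 by ring] at h2
  linarith [hspread x]

end Lift

/-! ### Minorization of the transition operator of the lifts -/

open scoped ENNReal

instance isProbabilityMeasure_nuI : IsProbabilityMeasure nuI := by
  constructor
  simp only [nuI, Measure.restrict_apply_univ, Real.volume_Icc]
  norm_num

lemma continuous_Gmap_uncurry (τ ε σ : ℝ) : Continuous fun p : ℝ × ℝ => Gmap τ ε σ p.1 p.2 := by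
  unfold Gmap
  fun_prop

/-- The transition operator of the lifted random walk, acting on nonnegative functions. -/
def liftOp (τ ε σ : ℝ) (f : ℝ → ℝ≥0∞) (x : ℝ) : ℝ≥0∞ :=
  ∫⁻ w, f (Gmap τ ε σ w x) ∂nuI

lemma measurable_liftOp (τ ε σ : ℝ) {f : ℝ → ℝ≥0∞} (hf : Measurable f) :
    Measurable (liftOp τ ε σ f) := by
  have : Measurable fun p : ℝ × ℝ => f (Gmap τ ε σ p.2 p.1) :=
    hf.comp ((continuous_Gmap_uncurry τ ε σ).measurable.comp measurable_swap)
  exact this.lintegral_prod_right'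

section Minorization

variable {τ ε σ : ℝ} (hε : 0 < ε) (hεπ : 2 * π * ε < 1) (hσ : 0 < σ)

include hσ in
lemma lintegral_Icc_le_mul_liftOp {s : ℝ} (hs : 0 < s) (hs1 : s < 1) (f : ℝ → ℝ≥0∞) (x : ℝ) :
    ∫⁻ u in Icc (Gmap τ ε σ (-(s / 2)) x) (Gmap τ ε σ (s / 2) x), f u ≤
      ENNReal.ofReal σ * liftOp τ ε σ f x := by
  have himg : Icc (Gmap τ ε σ (-(s / 2)) x) (Gmap τ ε σ (s / 2) x) ⊆
      (fun w => Gmap τ ε σ w x) '' Icc (-(s / 2)) (s / 2) :=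
    intermediate_value_Icc (by linarith)
      ((continuous_Gmap_uncurry τ ε σ).comp (by fun_prop : Continuous fun w : ℝ => (w, x))).continuousOn
  have hderiv : ∀ w : ℝ, HasDerivAt (fun w => Gmap τ ε σ w x) σ w := by
    intro w
    unfold Gmap
    simpa using (((hasDerivAt_id w).const_mul σ).const_add (x + τ)).sub_const
      (ε * Real.sin (2 * π * x))
  have hinj : Injective fun w => Gmap τ ε σ w x := by
    intro w w' h
    simp only [Gmap_eq_add τ ε σ w, Gmap_eq_add τ ε σ w', add_right_inj] at h
    exact mul_left_cancel₀ hσ.ne' h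
  calc ∫⁻ u in Icc (Gmap τ ε σ (-(s / 2)) x) (Gmap τ ε σ (s / 2) x), f u
      ≤ ∫⁻ u in (fun w => Gmap τ ε σ w x) '' Icc (-(s / 2)) (s / 2), f u :=
        lintegral_mono_set himg
    _ = ∫⁻ w in Icc (-(s / 2)) (s / 2), ENNReal.ofReal |σ| * f (Gmap τ ε σ w x) :=
        lintegral_image_eq_lintegral_abs_deriv_mul measurableSet_Icc
          (fun w _ => (hderiv w).hasDerivWithinAt) hinj.injOn f
    _ = ENNReal.ofReal σ * ∫⁻ w in Icc (-(s / 2)) (s / 2), f (Gmap τ ε σ w x) := by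
        rw [abs_of_pos hσ, lintegral_const_mul' _ _ ENNReal.ofReal_ne_top]
    _ ≤ ENNReal.ofReal σ * liftOp τ ε σ f x := by
        unfold liftOp nuI
        gcongr

include hε hεπ in
lemma lintegral_Icc_le_two_mul (f : ℝ → ℝ≥0∞) (w : ℝ) {a b : ℝ} (hab : a ≤ b) :
    ∫⁻ u in Icc (Gmap τ ε σ w a) (Gmap τ ε σ w b), f u ≤
      2 * ∫⁻ z in Icc a b, f (Gmap τ ε σ w z) := by
  have himg : Icc (Gmap τ ε σ w a) (Gmap τ ε σ w b) ⊆ Gmap τ ε σ w '' Icc a b :=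
    intermediate_value_Icc hab
      ((continuous_Gmap_uncurry τ ε σ).comp (by fun_prop : Continuous fun x : ℝ => (w, x))).continuousOn
  refine (lintegral_mono_set himg).trans ?_
  rw [lintegral_image_eq_lintegral_abs_deriv_mul measurableSet_Icc
    (fun z _ => (hasDerivAt_Gmap τ ε σ w z).hasDerivWithinAt) (strictMono_Gmap hε hεπ w).injective.injOn,
    ← lintegral_const_mul' _ _ (by simp)]
  refine lintegral_mono fun z => ?_
  gcongr
  rw [← ENNReal.ofReal_ofNat]
  apply ENNReal.ofReal_le_ofReal
  have h1 := one_sub_le_one_sub_mul_cos hε (2 * π * z)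
  rw [abs_of_nonneg (by linarith)]
  exact one_sub_mul_cos_le_two hε hεπ _

include hε hεπ hσ in
lemma exists_mul_lintegral_Icc_le_lintegral_liftOp {s : ℝ} (hs : 0 < s) (hs1 : s < 1) {d : ℝ}
    (hd : 0 < d) :
    ∃ c : ℝ≥0∞, c ≠ 0 ∧ ∀ f : ℝ → ℝ≥0∞, Measurable f → ∀ a b : ℝ, d ≤ b - a →
      c * ∫⁻ u in Icc (Gmap τ ε σ (-(s / 2)) a) (Gmap τ ε σ (s / 2) b), f u ≤
        ∫⁻ z in Icc a b, liftOp τ ε σ f z := by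
  set κ := min 1 (min ((1 - s) / 2) ((1 - 2 * π * ε) * d / σ)) with hκ
  have hκpos : 0 < κ := by
    have h1 : 0 < 1 - s := by linarith
    have h2 : 0 < 1 - 2 * π * ε := by linarith
    positivity
  have hκ1 : κ ≤ 1 := min_le_left _ _
  have hκ2 : κ ≤ (1 - s) / 2 := (min_le_right _ _).trans (min_le_left _ _)
  have hκ3 : κ ≤ (1 - 2 * π * ε) * d / σ := (min_le_right _ _).trans (min_le_right _ _)
  refine ⟨ENNReal.ofReal κ / 2, by simp [hκpos], fun f hf a b hab => ?_⟩
  have hgap := mul_sub_le_Gmap_sub (τ := τ) (σ := σ) hε 0 (show a ≤ b by linarith)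
  have hgap' : κ ≤ (Gmap τ ε σ 0 b - Gmap τ ε σ 0 a) / σ := by
    refine hκ3.trans ?_
    gcongr
    refine le_trans ?_ hgap
    have h2 : 0 < 1 - 2 * π * ε := by linarith
    gcongr
  have hpoint : ∀ u ∈ Icc (Gmap τ ε σ (-(s / 2)) a) (Gmap τ ε σ (s / 2) b),
      ENNReal.ofReal κ * f u ≤
        ∫⁻ w, (Icc (Gmap τ ε σ w a) (Gmap τ ε σ w b)).indicator f u ∂nuI := by
    intro u hu
    rw [mem_Icc, Gmap_eq_add τ ε σ (-(s / 2)), Gmap_eq_add τ ε σ (s / 2)] at hu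
    set A := Gmap τ ε σ 0 a
    set B := Gmap τ ε σ 0 b
    set α := max (-(1 / 2)) ((u - B) / σ) with hα
    set β := min (1 / 2) ((u - A) / σ) with hβ
    have h1 : (u - B) / σ ≤ s / 2 := by rw [div_le_iff₀ hσ]; linarith
    have h2 : -(s / 2) ≤ (u - A) / σ := by rw [le_div_iff₀ hσ]; linarith
    have h3 : (B - A) / σ = (u - A) / σ - (u - B) / σ := by ring
    have hlen : κ ≤ β - α := by
      rw [le_sub_iff_add_le, hα, hβ, ← max_add_add_left, max_le_iff, le_min_iff, le_min_iff]
      refine ⟨⟨?_, ?_⟩, ?_, ?_⟩ <;> linarith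
    have hsub : Icc α β ⊆ Icc (-(1 / 2) : ℝ) (1 / 2) :=
      Icc_subset_Icc (le_max_left _ _) (min_le_left _ _)
    calc ENNReal.ofReal κ * f u ≤ f u * ENNReal.ofReal (β - α) := by
          rw [mul_comm]; gcongr
      _ = ∫⁻ _ in Icc α β, f u := by simp
      _ = ∫⁻ w in Icc α β, (Icc (Gmap τ ε σ w a) (Gmap τ ε σ w b)).indicator f u := by
          refine setLIntegral_congr_fun measurableSet_Icc fun w hw => ?_
          have hw1 : (u - B) / σ ≤ w := (le_max_right _ _).trans hw.1
          have hw2 : w ≤ (u - A) / σ := hw.2.trans (min_le_right _ _)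
          rw [div_le_iff₀ hσ] at hw1
          rw [le_div_iff₀ hσ] at hw2
          have : u ∈ Icc (Gmap τ ε σ w a) (Gmap τ ε σ w b) := by
            rw [mem_Icc, Gmap_eq_add τ ε σ w a, Gmap_eq_add τ ε σ w b]
            constructor <;> linarith
          exact (indicator_of_mem this f).symm
      _ ≤ _ := by
          unfold nuI
          exact lintegral_mono_set hsub
  have hmeas1 : Measurable fun p : ℝ × ℝ => f (Gmap τ ε σ p.2 p.1) :=
    hf.comp ((continuous_Gmap_uncurry τ ε σ).measurable.comp measurable_swap)
  have hG : ∀ x, Measurable fun p : ℝ × ℝ => Gmap τ ε σ p.1 x := fun x =>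
    ((continuous_Gmap_uncurry τ ε σ).comp (by fun_prop : Continuous fun p : ℝ × ℝ => (p.1, x))).measurable
  have hmeas2 : Measurable fun p : ℝ × ℝ =>
      (Icc (Gmap τ ε σ p.1 a) (Gmap τ ε σ p.1 b)).indicator f p.2 := by
    have hS : MeasurableSet {p : ℝ × ℝ | p.2 ∈ Icc (Gmap τ ε σ p.1 a) (Gmap τ ε σ p.1 b)} :=
      (measurableSet_le (hG a) measurable_snd).inter (measurableSet_le measurable_snd (hG b))
    exact (hf.comp measurable_snd).indicator hS
  have hmain : ENNReal.ofReal κ *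
      ∫⁻ u in Icc (Gmap τ ε σ (-(s / 2)) a) (Gmap τ ε σ (s / 2) b), f u ≤
        2 * ∫⁻ z in Icc a b, liftOp τ ε σ f z := by
    calc _ = ∫⁻ u in Icc (Gmap τ ε σ (-(s / 2)) a) (Gmap τ ε σ (s / 2) b),
          ENNReal.ofReal κ * f u := (lintegral_const_mul' _ _ ENNReal.ofReal_ne_top).symm
      _ ≤ ∫⁻ u in Icc (Gmap τ ε σ (-(s / 2)) a) (Gmap τ ε σ (s / 2) b),
          ∫⁻ w, (Icc (Gmap τ ε σ w a) (Gmap τ ε σ w b)).indicator f u ∂nuI :=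
          setLIntegral_mono' measurableSet_Icc hpoint
      _ ≤ ∫⁻ u, ∫⁻ w, (Icc (Gmap τ ε σ w a) (Gmap τ ε σ w b)).indicator f u ∂nuI :=
          setLIntegral_le_lintegral _ _
      _ = ∫⁻ w, (∫⁻ u, (Icc (Gmap τ ε σ w a) (Gmap τ ε σ w b)).indicator f u) ∂nuI :=
          (lintegral_lintegral_swap hmeas2.aemeasurable).symm
      _ = ∫⁻ w, (∫⁻ u in Icc (Gmap τ ε σ w a) (Gmap τ ε σ w b), f u) ∂nuI := by
          simp_rw [lintegral_indicator measurableSet_Icc]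
      _ ≤ ∫⁻ w, 2 * (∫⁻ z in Icc a b, f (Gmap τ ε σ w z)) ∂nuI :=
          lintegral_mono fun w => lintegral_Icc_le_two_mul hε hεπ f w (by linarith)
      _ = 2 * ∫⁻ w, (∫⁻ z in Icc a b, f (Gmap τ ε σ w z)) ∂nuI :=
          lintegral_const_mul' _ _ (by simp)
      _ = _ := by
          unfold liftOp
          rw [← lintegral_lintegral_swap hmeas1.aemeasurable]
  rw [ENNReal.mul_comm_div, ← mul_div_assoc]
  exact ENNReal.div_le_of_le_mul' hmain

include hε hεπ hσ in
/-- The `n`-step transition operator dominates Lebesgue measure on the interval swept out by the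
noise of relative size `s < 1`. -/
lemma exists_mul_lintegral_Icc_le_iterate_liftOp {s : ℝ} (hs : 0 < s) (hs1 : s < 1) {n : ℕ}
    (hn : n ≠ 0) :
    ∃ c : ℝ≥0∞, c ≠ 0 ∧ ∀ f : ℝ → ℝ≥0∞, Measurable f → ∀ x,
      c * ∫⁻ u in Icc ((Gmap τ ε σ (-(s / 2)))^[n] x) ((Gmap τ ε σ (s / 2))^[n] x), f u ≤
        (liftOp τ ε σ)^[n] f x := by
  induction n, Nat.one_le_iff_ne_zero.2 hn using Nat.le_induction with
  | base =>
    refine ⟨(ENNReal.ofReal σ)⁻¹, by simp, fun f _ x => ?_⟩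
    have := lintegral_Icc_le_mul_liftOp (τ := τ) (ε := ε) hσ hs hs1 f x
    rw [mul_comm, ← div_eq_mul_inv]
    exact ENNReal.div_le_of_le_mul' this
  | succ n hn1 ih =>
    obtain ⟨c, hc, hcf⟩ := ih (by omega)
    obtain ⟨c', hc', hcf'⟩ := exists_mul_lintegral_Icc_le_lintegral_liftOp (τ := τ) hε hεπ hσ hs hs1
      (mul_pos hσ hs)
    refine ⟨c * c', mul_ne_zero hc hc', fun f hf x => ?_⟩
    rw [iterate_succ_apply (liftOp τ ε σ), iterate_succ_apply', iterate_succ_apply', mul_assoc]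
    refine le_trans ?_ (hcf _ (measurable_liftOp τ ε σ hf) x)
    gcongr
    refine hcf' f hf _ _ ?_
    have := iterate_Gmap_add_le (τ := τ) hε hεπ hσ (a := -(s / 2)) (b := s / 2) (by linarith) x
      (n := n) (by omega)
    rw [show s / 2 - -(s / 2) = s by ring] at this
    linarith

end Minorization

/-! ### The random walk on the circle -/

lemma sinA_coe (x : ℝ) : sinA (x : AddCircle (1 : ℝ)) = Real.sin (2 * π * x) := rfl

lemma continuous_sinA : Continuous sinA :=
  (QuotientAddGroup.isQuotientMap_mk (N := AddSubgroup.zmultiples (1 : ℝ))).continuous_iff.2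
    (by change Continuous fun x : ℝ => Real.sin (2 * π * x); fun_prop)

lemma continuous_cosA : Continuous cosA :=
  (QuotientAddGroup.isQuotientMap_mk (N := AddSubgroup.zmultiples (1 : ℝ))).continuous_iff.2
    (by change Continuous fun x : ℝ => Real.cos (2 * π * x); fun_prop)

lemma Fmap_coe (τ ε σ w x : ℝ) :
    Fmap τ ε σ w (x : AddCircle (1 : ℝ)) = (Gmap τ ε σ w x : ℝ) := by
  rw [Fmap, sinA_coe, ← AddCircle.coe_add, Gmap]
  congr 1
  ring

lemma Fmap_eq_add (τ ε σ w : ℝ) (x : AddCircle (1 : ℝ)) :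
    Fmap τ ε σ w x = Fmap τ ε σ 0 x + ((σ * w : ℝ) : AddCircle (1 : ℝ)) := by
  induction x using QuotientAddGroup.induction_on with
  | H x => erw [Fmap_coe, Fmap_coe, Gmap_eq_add, AddCircle.coe_add]

lemma continuous_Fmap_uncurry (τ ε σ : ℝ) :
    Continuous fun p : ℝ × AddCircle (1 : ℝ) => Fmap τ ε σ p.1 p.2 := by
  have h1 := continuous_sinA
  have h2 : Continuous fun p : ℝ × AddCircle (1 : ℝ) =>
      ((τ + σ * p.1 - ε * sinA p.2 : ℝ) : AddCircle (1 : ℝ)) :=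
    (AddCircle.continuous_mk' (1 : ℝ)).comp (by fun_prop)
  exact continuous_snd.add h2

lemma continuous_Fder (ε : ℝ) : Continuous (Fder ε) := by
  have := continuous_cosA
  unfold Fder
  fun_prop

lemma Fder_coe (ε x : ℝ) :
    Fder ε (x : AddCircle (1 : ℝ)) = 1 - 2 * π * ε * Real.cos (2 * π * x) := rfl

lemma one_sub_le_Fder {ε : ℝ} (hε : 0 < ε) (x : AddCircle (1 : ℝ)) : 1 - 2 * π * ε ≤ Fder ε x := by
  induction x using QuotientAddGroup.induction_on with
  | H x => exact one_sub_le_one_sub_mul_cos hε _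

lemma Fder_le_two {ε : ℝ} (hε : 0 < ε) (hεπ : 2 * π * ε < 1) (x : AddCircle (1 : ℝ)) :
    Fder ε x ≤ 2 := by
  induction x using QuotientAddGroup.induction_on with
  | H x => exact one_sub_mul_cos_le_two hε hεπ _

lemma Fder_pos {ε : ℝ} (hε : 0 < ε) (hεπ : 2 * π * ε < 1) (x : AddCircle (1 : ℝ)) :
    0 < Fder ε x := (sub_pos.2 hεπ).trans_le (one_sub_le_Fder hε x)

/-- The transition operator of the random walk, acting on nonnegative functions. -/
def circleOp (τ ε σ : ℝ) (f : AddCircle (1 : ℝ) → ℝ≥0∞) (x : AddCircle (1 : ℝ)) : ℝ≥0∞ :=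
  ∫⁻ w, f (Fmap τ ε σ w x) ∂nuI

lemma measurable_circleOp (τ ε σ : ℝ) {f : AddCircle (1 : ℝ) → ℝ≥0∞} (hf : Measurable f) :
    Measurable (circleOp τ ε σ f) := by
  have : Measurable fun p : AddCircle (1 : ℝ) × ℝ => f (Fmap τ ε σ p.2 p.1) :=
    hf.comp ((continuous_Fmap_uncurry τ ε σ).measurable.comp measurable_swap)
  exact this.lintegral_prod_right'

lemma iterate_circleOp_coe (τ ε σ : ℝ) (n : ℕ) (f : AddCircle (1 : ℝ) → ℝ≥0∞) (x : ℝ) :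
    (circleOp τ ε σ)^[n] f x = (liftOp τ ε σ)^[n] (fun y : ℝ => f y) x := by
  induction n generalizing f with
  | zero => rfl
  | succ n ih =>
    rw [iterate_succ_apply, iterate_succ_apply, ih]
    have : (fun y : ℝ => circleOp τ ε σ f y) = liftOp τ ε σ fun y : ℝ => f y := by
      funext y
      simp only [circleOp, liftOp, Fmap_coe]
    rw [this]

lemma measurable_coe_addCircle : Measurable fun x : ℝ => (x : AddCircle (1 : ℝ)) :=
  (AddCircle.continuous_mk' (1 : ℝ)).measurable

/-- Doeblin's condition for the random walk on the circle. -/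
lemma exists_doeblin {τ ε σ : ℝ} (hε : 0 < ε) (hεπ : 2 * π * ε < 1) (hσ : 0 < σ) {ρ : ℝ}
    (hirr : Irrational ρ) {ω : ℤ → ℝ} (hω : ∀ n : ℕ, ω n ∈ Icc (-(1 / 2) : ℝ) (1 / 2))
    (hρ : Tendsto (fun n : ℕ => (Gn τ ε σ ω n 0 - 0) / n) atTop (nhds ρ)) :
    ∃ n : ℕ, ∃ c : ℝ≥0∞, c ≠ 0 ∧ ∀ f : AddCircle (1 : ℝ) → ℝ≥0∞, Measurable f → ∀ x,
      c * ∫⁻ y, f y ≤ (circleOp τ ε σ)^[n] f x := by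
  obtain ⟨s, hs, hs1, n, hn, hspread⟩ := exists_iterate_spread hε hεπ hσ hirr hω hρ
  obtain ⟨c, hc, hcf⟩ := exists_mul_lintegral_Icc_le_iterate_liftOp (τ := τ) hε hεπ hσ hs hs1 hn
  refine ⟨n, c, hc, fun f hf x => ?_⟩
  induction x using QuotientAddGroup.induction_on with
  | H x =>
    have h := hcf (fun y : ℝ => f y) (hf.comp measurable_coe_addCircle) x
    refine le_trans ?_ (h.trans (iterate_circleOp_coe τ ε σ n f x).ge)
    gcongr
    rw [← AddCircle.lintegral_preimage 1 ((Gmap τ ε σ (-(s / 2)))^[n] x)]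
    exact lintegral_mono_set (Ioc_subset_Icc_self.trans (Icc_subset_Icc_right (hspread x)))

lemma lintegral_Ioc_add_nat (f : AddCircle (1 : ℝ) → ℝ≥0∞) (a : ℝ) (N : ℕ) :
    ∫⁻ u in Ioc a (a + N), f (u : ℝ) = N * ∫⁻ y, f y := by
  induction N with
  | zero => simp
  | succ N ih =>
    rw [← Ioc_union_Ioc_eq_Ioc (b := a + N) (by simp) (by simp),
      lintegral_union measurableSet_Ioc (Ioc_disjoint_Ioc_of_le le_rfl), ih]
    have := AddCircle.lintegral_preimage 1 (a + N) f
    rw [add_assoc] at this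
    push_cast
    rw [this]
    ring

lemma circleOp_le {τ ε σ : ℝ} (hσ : 0 < σ) (f : AddCircle (1 : ℝ) → ℝ≥0∞) (x : AddCircle (1 : ℝ)) :
    circleOp τ ε σ f x ≤ ((ENNReal.ofReal σ)⁻¹ * ⌈σ⌉₊) * ∫⁻ y, f y := by
  induction x using QuotientAddGroup.induction_on with
  | H x =>
    have hderiv : ∀ w : ℝ, HasDerivAt (fun w => Gmap τ ε σ w x) σ w := by
      intro w
      unfold Gmap
      simpa using (((hasDerivAt_id w).const_mul σ).const_add (x + τ)).sub_const
        (ε * Real.sin (2 * π * x))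
    have hinj : Injective fun w => Gmap τ ε σ w x := by
      intro w w' h
      simp only [Gmap_eq_add τ ε σ w, Gmap_eq_add τ ε σ w', add_right_inj] at h
      exact mul_left_cancel₀ hσ.ne' h
    set a := Gmap τ ε σ (-(1 / 2)) x with ha
    have himg : (fun w => Gmap τ ε σ w x) '' Icc (-(1 / 2)) (1 / 2) ⊆ Icc a (a + ⌈σ⌉₊) := by
      rintro _ ⟨w, hw, rfl⟩
      have h1 := mul_le_mul_of_nonneg_left hw.1 hσ.le
      have h2 := mul_le_mul_of_nonneg_left hw.2 hσ.le
      have h3 := Nat.le_ceil σ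
      simp only [mem_Icc, ha, Gmap_eq_add τ ε σ w x, Gmap_eq_add τ ε σ (-(1 / 2)) x]
      constructor <;> linarith
    have hmain : ENNReal.ofReal σ * circleOp τ ε σ f x ≤ ⌈σ⌉₊ * ∫⁻ y, f y := by
      calc ENNReal.ofReal σ * circleOp τ ε σ f x
          = ∫⁻ w in Icc (-(1 / 2)) (1 / 2), ENNReal.ofReal |σ| * f (Gmap τ ε σ w x : ℝ) := by
            rw [abs_of_pos hσ, lintegral_const_mul' _ _ ENNReal.ofReal_ne_top]
            simp only [circleOp, Fmap_coe, nuI]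
        _ = ∫⁻ u in (fun w => Gmap τ ε σ w x) '' Icc (-(1 / 2)) (1 / 2), f (u : ℝ) :=
            (lintegral_image_eq_lintegral_abs_deriv_mul measurableSet_Icc
              (fun w _ => (hderiv w).hasDerivWithinAt) hinj.injOn (fun u : ℝ => f u)).symm
        _ ≤ ∫⁻ u in Icc a (a + ⌈σ⌉₊), f (u : ℝ) := lintegral_mono_set himg
        _ = ∫⁻ u in Ioc a (a + ⌈σ⌉₊), f (u : ℝ) := by
            rw [restrict_Ioc_eq_restrict_Icc]
        _ = _ := lintegral_Ioc_add_nat f a _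
    have hσ0 : ENNReal.ofReal σ ≠ 0 := by simpa using hσ
    calc circleOp τ ε σ f x
        = (ENNReal.ofReal σ)⁻¹ * (ENNReal.ofReal σ * circleOp τ ε σ f x) := by
          rw [← mul_assoc, ENNReal.inv_mul_cancel hσ0 ENNReal.ofReal_ne_top, one_mul]
      _ ≤ _ := by rw [mul_assoc]; gcongr

/-- Change of variables along the circle diffeomorphism `F_w`. -/
lemma lintegral_Fder_mul_comp_Fmap {τ ε σ : ℝ} (hε : 0 < ε) (hεπ : 2 * π * ε < 1) (w : ℝ)
    (f : AddCircle (1 : ℝ) → ℝ≥0∞) :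
    ∫⁻ x, ENNReal.ofReal (Fder ε x) * f (Fmap τ ε σ w x) = ∫⁻ x, f x := by
  have himg : Gmap τ ε σ w '' Ioc 0 (0 + 1) = Ioc (Gmap τ ε σ w 0) (Gmap τ ε σ w 0 + 1) := by
    have h1 : Gmap τ ε σ w (0 + 1) = Gmap τ ε σ w 0 + 1 :=
      (circleLift τ ε σ hε hεπ w).map_add_one 0
    rw [← h1]
    refine Subset.antisymm ?_ (intermediate_value_Ioc (by norm_num) ?_)
    · rintro _ ⟨x, hx, rfl⟩
      exact ⟨strictMono_Gmap hε hεπ w hx.1, (strictMono_Gmap hε hεπ w).monotone hx.2⟩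
    · exact ((continuous_Gmap_uncurry τ ε σ).comp
        (by fun_prop : Continuous fun x : ℝ => (w, x))).continuousOn
  rw [← AddCircle.lintegral_preimage 1 (Gmap τ ε σ w 0) f, ← himg,
    lintegral_image_eq_lintegral_abs_deriv_mul measurableSet_Ioc
    (fun z _ => (hasDerivAt_Gmap τ ε σ w z).hasDerivWithinAt)
    (strictMono_Gmap hε hεπ w).injective.injOn, ← AddCircle.lintegral_preimage 1 0]
  refine lintegral_congr fun x => ?_
  rw [Fmap_coe, ← Fder_coe, abs_of_pos (Fder_pos hε hεπ _)]

lemma lintegral_circleOp_eq {τ ε σ : ℝ} {m : Measure (AddCircle (1 : ℝ))} [IsProbabilityMeasure m]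
    (hstat : IsStationaryNoisy τ ε σ m) {f : AddCircle (1 : ℝ) → ℝ≥0∞} (hf : Measurable f) :
    ∫⁻ x, circleOp τ ε σ f x ∂m = ∫⁻ x, f x ∂m := by
  have hF : ∀ w, Measurable (Fmap τ ε σ w) := fun w =>
    ((continuous_Fmap_uncurry τ ε σ).comp (by fun_prop : Continuous fun x => (w, x))).measurable
  have hmeas : Measurable fun w => m.map (Fmap τ ε σ w) := by
    refine Measure.measurable_of_measurable_coe _ fun S hS => ?_
    simp_rw [Measure.map_apply (hF _) hS]
    exact measurable_measure_prodMk_left ((continuous_Fmap_uncurry τ ε σ).measurable hS)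
  have hjoint : Measurable fun p : ℝ × AddCircle (1 : ℝ) => f (Fmap τ ε σ p.1 p.2) :=
    hf.comp (continuous_Fmap_uncurry τ ε σ).measurable
  have h : ∫⁻ x, f x ∂(nuI.bind fun w => m.map (Fmap τ ε σ w)) = ∫⁻ x, f x ∂m := by
    rw [show (nuI.bind fun w => m.map (Fmap τ ε σ w)) = m from hstat]
  rw [← h, Measure.lintegral_bind hmeas.aemeasurable hf.aemeasurable]
  simp_rw [lintegral_map hf (hF _)]
  exact (lintegral_lintegral_swap hjoint.aemeasurable).symm

lemma lintegral_iterate_circleOp_eq {τ ε σ : ℝ} {m : Measure (AddCircle (1 : ℝ))}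
    [IsProbabilityMeasure m] (hstat : IsStationaryNoisy τ ε σ m) (n : ℕ)
    {f : AddCircle (1 : ℝ) → ℝ≥0∞} (hf : Measurable f) :
    ∫⁻ x, (circleOp τ ε σ)^[n] f x ∂m = ∫⁻ x, f x ∂m := by
  induction n generalizing f with
  | zero => rfl
  | succ n ih =>
    rw [iterate_succ_apply, ih (measurable_circleOp τ ε σ hf), lintegral_circleOp_eq hstat hf]

/-! ### The transition operator on bounded functions -/

/-- The transition operator of the random walk, acting on bounded measurable functions. -/
def realOp (τ ε σ : ℝ) (f : AddCircle (1 : ℝ) → ℝ) (x : AddCircle (1 : ℝ)) : ℝ :=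
  ∫ w, f (Fmap τ ε σ w x) ∂nuI

lemma measurable_realOp (τ ε σ : ℝ) {f : AddCircle (1 : ℝ) → ℝ} (hf : Measurable f) :
    Measurable (realOp τ ε σ f) := by
  have : Measurable fun p : AddCircle (1 : ℝ) × ℝ => f (Fmap τ ε σ p.2 p.1) :=
    hf.comp ((continuous_Fmap_uncurry τ ε σ).measurable.comp measurable_swap)
  exact (this.stronglyMeasurable.integral_prod_right').measurable

instance isProbabilityMeasure_volume_addCircle :
    IsProbabilityMeasure (volume : Measure (AddCircle (1 : ℝ))) :=
  ⟨by simp⟩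

lemma integrable_of_mem_Icc {α : Type*} [MeasurableSpace α] {μ : Measure α} [IsFiniteMeasure μ]
    {f : α → ℝ} (hf : Measurable f) {a b : ℝ} (hab : ∀ x, f x ∈ Icc a b) : Integrable f μ :=
  Integrable.of_mem_Icc a b hf.aemeasurable (.of_forall hab)

lemma measurable_comp_Fmap (τ ε σ : ℝ) {f : AddCircle (1 : ℝ) → ℝ} (hf : Measurable f)
    (x : AddCircle (1 : ℝ)) : Measurable fun w => f (Fmap τ ε σ w x) :=
  hf.comp ((continuous_Fmap_uncurry τ ε σ).comp
    (by fun_prop : Continuous fun w : ℝ => (w, x))).measurable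

section BoundedFunctions

variable {τ ε σ : ℝ} {f : AddCircle (1 : ℝ) → ℝ} {a b : ℝ}

lemma realOp_mem_Icc (hf : Measurable f) (hab : ∀ x, f x ∈ Icc a b) (x : AddCircle (1 : ℝ)) :
    realOp τ ε σ f x ∈ Icc a b := by
  have hint : Integrable (fun w => f (Fmap τ ε σ w x)) nuI :=
    integrable_of_mem_Icc (measurable_comp_Fmap τ ε σ hf x) fun w => hab _
  rw [realOp]
  constructor
  · simpa using integral_mono (integrable_const a) hint fun w => (hab (Fmap τ ε σ w x)).1
  · simpa using integral_mono hint (integrable_const b) fun w => (hab (Fmap τ ε σ w x)).2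

lemma iterate_realOp (hf : Measurable f) (hab : ∀ x, f x ∈ Icc a b) (n : ℕ) :
    Measurable ((realOp τ ε σ)^[n] f) ∧ ∀ x, (realOp τ ε σ)^[n] f x ∈ Icc a b := by
  induction n with
  | zero => exact ⟨hf, hab⟩
  | succ n ih =>
    rw [iterate_succ_apply']
    exact ⟨measurable_realOp τ ε σ ih.1, realOp_mem_Icc ih.1 ih.2⟩

lemma realOp_const_sub (hf : Measurable f) (hab : ∀ x, f x ∈ Icc a b) (k : ℝ) :
    realOp τ ε σ (fun x => k - f x) = fun x => k - realOp τ ε σ f x := by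
  funext x
  simp only [realOp]
  rw [integral_sub (integrable_const k)
    (integrable_of_mem_Icc (measurable_comp_Fmap τ ε σ hf x) fun w => hab _)]
  simp

lemma iterate_realOp_const_sub (hf : Measurable f) (hab : ∀ x, f x ∈ Icc a b) (k : ℝ) (n : ℕ) :
    (realOp τ ε σ)^[n] (fun x => k - f x) = fun x => k - (realOp τ ε σ)^[n] f x := by
  induction n with
  | zero => rfl
  | succ n ih =>
    have h := iterate_realOp (τ := τ) (ε := ε) (σ := σ) hf hab n
    rw [iterate_succ_apply', iterate_succ_apply', ih, realOp_const_sub h.1 h.2]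

lemma ofReal_iterate_realOp (hf : Measurable f) (hab : ∀ x, f x ∈ Icc 0 b) (n : ℕ) :
    (fun x => ENNReal.ofReal ((realOp τ ε σ)^[n] f x)) =
      (circleOp τ ε σ)^[n] fun x => ENNReal.ofReal (f x) := by
  induction n with
  | zero => rfl
  | succ n ih =>
    have h := iterate_realOp (τ := τ) (ε := ε) (σ := σ) hf hab n
    rw [iterate_succ_apply', iterate_succ_apply', ← ih]
    funext x
    exact ofReal_integral_eq_lintegral_ofReal
      (integrable_of_mem_Icc (measurable_comp_Fmap τ ε σ h.1 x) fun w => h.2 _)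
      (.of_forall fun w => (h.2 _).1)

lemma integral_iterate_realOp_of_nonneg {m : Measure (AddCircle (1 : ℝ))} [IsProbabilityMeasure m]
    (hstat : IsStationaryNoisy τ ε σ m) (hf : Measurable f) (hab : ∀ x, f x ∈ Icc 0 b) (n : ℕ) :
    ∫ x, (realOp τ ε σ)^[n] f x ∂m = ∫ x, f x ∂m := by
  have h := iterate_realOp (τ := τ) (ε := ε) (σ := σ) hf hab n
  rw [integral_eq_lintegral_of_nonneg_ae (.of_forall fun x => (h.2 x).1)
    h.1.aestronglyMeasurable, integral_eq_lintegral_of_nonneg_ae (.of_forall fun x => (hab x).1)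
    hf.aestronglyMeasurable, ofReal_iterate_realOp hf hab n,
    lintegral_iterate_circleOp_eq hstat n hf.ennreal_ofReal]

lemma integral_iterate_realOp {m : Measure (AddCircle (1 : ℝ))} [IsProbabilityMeasure m]
    (hstat : IsStationaryNoisy τ ε σ m) (hf : Measurable f) (hab : ∀ x, f x ∈ Icc a b) (n : ℕ) :
    ∫ x, (realOp τ ε σ)^[n] f x ∂m = ∫ x, f x ∂m := by
  have h := iterate_realOp (τ := τ) (ε := ε) (σ := σ) hf hab n
  have h1 := integral_iterate_realOp_of_nonneg hstat (f := fun x => b - f x) (b := b - a)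
    (measurable_const.sub hf) (fun x => ⟨by linarith [(hab x).2], by linarith [(hab x).1]⟩) n
  rw [iterate_realOp_const_sub hf hab, integral_sub (integrable_const b)
    (integrable_of_mem_Icc h.1 h.2), integral_sub (integrable_const b)
    (integrable_of_mem_Icc hf hab)] at h1
  linarith

/-- Under Doeblin's condition the operator contracts oscillations. -/
lemma exists_iterate_realOp_mem_Icc {n : ℕ} {c : ℝ≥0∞}
    (hc : ∀ f : AddCircle (1 : ℝ) → ℝ≥0∞, Measurable f → ∀ x,
      c * ∫⁻ y, f y ≤ (circleOp τ ε σ)^[n] f x)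
    (hf : Measurable f) (hab : ∀ x, f x ∈ Icc a b) :
    ∃ a' b', b' - a' = (1 - c.toReal) * (b - a) ∧ ∀ x, (realOp τ ε σ)^[n] f x ∈ Icc a' b' := by
  have key : ∀ {g : AddCircle (1 : ℝ) → ℝ} {k : ℝ}, Measurable g → (∀ x, g x ∈ Icc 0 k) →
      ∀ x, c.toReal * ∫ y, g y ≤ (realOp τ ε σ)^[n] g x := by
    intro g k hg hk x
    have h := hc _ hg.ennreal_ofReal x
    rw [← ofReal_iterate_realOp hg hk n, ← ofReal_integral_eq_lintegral_ofReal
      (integrable_of_mem_Icc hg hk) (.of_forall fun x => (hk x).1)] at h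
    have h' := ENNReal.toReal_mono ENNReal.ofReal_ne_top h
    rwa [ENNReal.toReal_mul, ENNReal.toReal_ofReal (integral_nonneg fun x => (hk x).1),
      ENNReal.toReal_ofReal ((iterate_realOp (τ := τ) (ε := ε) (σ := σ) hg hk n).2 x).1] at h'
  have hi := integrable_of_mem_Icc (μ := volume) hf hab
  refine ⟨a + c.toReal * ((∫ y, f y) - a), b - c.toReal * (b - ∫ y, f y), by ring, fun x => ?_⟩
  have h1 := key (g := fun x => b - f x) (k := b - a) (measurable_const.sub hf)
    (fun x => ⟨by linarith [(hab x).2], by linarith [(hab x).1]⟩) x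
  have h2 := key (g := fun x => b - a - (b - f x)) (k := b - a)
    (measurable_const.sub (measurable_const.sub hf))
    (fun x => ⟨by linarith [(hab x).1], by linarith [(hab x).2]⟩) x
  rw [iterate_realOp_const_sub hf hab, integral_sub (integrable_const b) hi] at h1
  rw [iterate_realOp_const_sub (f := fun x => b - f x) (a := 0) (b := b - a)
    (measurable_const.sub hf) (fun x => ⟨by linarith [(hab x).2], by linarith [(hab x).1]⟩),
    iterate_realOp_const_sub hf hab] at h2
  have h3 : ∫ y, (b - a - (b - f y)) = (∫ y, f y) - a := by
    simp_rw [show ∀ y, b - a - (b - f y) = f y - a from fun y => by ring]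
    rw [integral_sub hi (integrable_const a)]
    simp
  rw [h3] at h2
  simp only [integral_const, probReal_univ, one_smul] at h1 h2
  constructor <;> linarith

/-- Under Doeblin's condition the iterates of a centred function converge uniformly to zero. -/
lemma exists_abs_iterate_realOp_le {m : Measure (AddCircle (1 : ℝ))} [IsProbabilityMeasure m]
    (hstat : IsStationaryNoisy τ ε σ m) {n : ℕ} {c : ℝ≥0∞} (hc0 : c ≠ 0)
    (hc : ∀ f : AddCircle (1 : ℝ) → ℝ≥0∞, Measurable f → ∀ x,
      c * ∫⁻ y, f y ≤ (circleOp τ ε σ)^[n] f x)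
    (hf : Measurable f) (hab : ∀ x, f x ∈ Icc a b) (hzero : ∫ x, f x ∂m = 0)
    {η : ℝ} (hη : 0 < η) :
    ∃ K : ℕ, ∀ x, |(realOp τ ε σ)^[K] f x| ≤ η := by
  have hc1 : c ≤ 1 := by
    have h := hc (fun _ => ENNReal.ofReal 1) measurable_const 0
    have h1 : ∀ x : AddCircle (1 : ℝ), (fun _ : AddCircle (1 : ℝ) => (1 : ℝ)) x ∈ Icc (0 : ℝ) 1 :=
      fun x => by simp
    rw [← ofReal_iterate_realOp measurable_const h1 n] at h
    have h2 := ((iterate_realOp (τ := τ) (ε := ε) (σ := σ) measurable_const h1 n).2 0).2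
    simpa using h.trans (ENNReal.ofReal_le_ofReal h2)
  have hctop : c ≠ ⊤ := ne_top_of_le_ne_top ENNReal.one_ne_top hc1
  have hcpos : 0 < c.toReal := ENNReal.toReal_pos hc0 hctop
  have hcle : c.toReal ≤ 1 := by simpa using ENNReal.toReal_mono ENNReal.one_ne_top hc1
  have hiter : ∀ j : ℕ, ∃ a' b', b' - a' = (1 - c.toReal) ^ j * (b - a) ∧
      ∀ x, (realOp τ ε σ)^[n * j] f x ∈ Icc a' b' := by
    intro j
    induction j with
    | zero => exact ⟨a, b, by simp, hab⟩
    | succ j ih =>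
      obtain ⟨a', b', hlen, hab'⟩ := ih
      have hm := (iterate_realOp (τ := τ) (ε := ε) (σ := σ) hf hab (n * j)).1
      obtain ⟨a'', b'', hlen', hab''⟩ := exists_iterate_realOp_mem_Icc hc hm hab'
      refine ⟨a'', b'', by rw [hlen', hlen]; ring, fun x => ?_⟩
      rw [mul_add, mul_one, add_comm, iterate_add_apply]
      exact hab'' x
  have hlim : Tendsto (fun j : ℕ => (1 - c.toReal) ^ j * (b - a)) atTop (nhds (0 * (b - a))) :=
    (tendsto_pow_atTop_nhds_zero_of_lt_one (by linarith) (by linarith)).mul_const _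
  rw [zero_mul] at hlim
  obtain ⟨j, hj⟩ := (hlim.eventually_le_const hη).exists
  obtain ⟨a', b', hlen, hab'⟩ := hiter j
  have hm := (iterate_realOp (τ := τ) (ε := ε) (σ := σ) hf hab (n * j)).1
  have hint := integral_iterate_realOp hstat hf hab (n * j)
  have hi := integrable_of_mem_Icc (μ := m) hm hab'
  have ha' : a' ≤ 0 := by
    have := integral_mono (integrable_const a') hi fun x => (hab' x).1
    rw [hint, hzero] at this
    simpa using this
  have hb' : 0 ≤ b' := by
    have := integral_mono hi (integrable_const b') fun x => (hab' x).2
    rw [hint, hzero] at this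
    simpa using this
  refine ⟨n * j, fun x => abs_le.2 ⟨?_, ?_⟩⟩ <;> linarith [(hab' x).1, (hab' x).2]

end BoundedFunctions

/-! ### A strong law for bounded martingale differences -/

/-- Bounded differences that are orthogonal to the past sums satisfy the strong law of large
numbers. -/
lemma ae_tendsto_sum_div_of_integral_eq_zero {Ω : Type*} [MeasurableSpace Ω] {P : Measure Ω}
    [IsProbabilityMeasure P] {D : ℕ → Ω → ℝ} {C : ℝ} (hD : ∀ k, Measurable (D k))
    (hC : ∀ k ω, |D k ω| ≤ C)
    (horth : ∀ n, ∫ ω, (∑ k ∈ Finset.range n, D k ω) * D n ω ∂P = 0) :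
    ∀ᵐ ω ∂P, Tendsto (fun n : ℕ => (∑ k ∈ Finset.range n, D k ω) / n) atTop (nhds 0) := by
  set M : ℕ → Ω → ℝ := fun n ω => ∑ k ∈ Finset.range n, D k ω with hM
  have hMm : ∀ n, Measurable (M n) := fun n => Finset.measurable_sum _ fun k _ => hD k
  have hMb : ∀ n ω, |M n ω| ≤ n * C := fun n ω =>
    (Finset.abs_sum_le_sum_abs _ _).trans <| by
      simpa using Finset.sum_le_sum fun k (_ : k ∈ Finset.range n) => hC k ω
  have hint : ∀ {g : Ω → ℝ} (B : ℝ), Measurable g → (∀ ω, |g ω| ≤ B) → Integrable g P :=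
    fun B hg hB => integrable_of_mem_Icc (a := -B) (b := B) hg fun ω => abs_le.1 (hB ω)
  have hMsq : ∀ n, Integrable (fun ω => M n ω ^ 2) P := fun n =>
    hint ((n * C) ^ 2) ((hMm n).pow_const 2) fun ω => by
      rw [abs_pow]
      exact pow_le_pow_left₀ (abs_nonneg _) (hMb n ω) 2
  have hDsq : ∀ n, Integrable (fun ω => D n ω ^ 2) P := fun n =>
    hint (C ^ 2) ((hD n).pow_const 2) fun ω => by
      rw [abs_pow]
      exact pow_le_pow_left₀ (abs_nonneg _) (hC n ω) 2
  have hMD : ∀ n, Integrable (fun ω => M n ω * D n ω) P := fun n =>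
    hint (n * C * C) ((hMm n).mul (hD n)) fun ω => by
      rw [abs_mul]
      exact mul_le_mul (hMb n ω) (hC n ω) (abs_nonneg _) ((abs_nonneg _).trans (hMb n ω))
  have hvar : ∀ n : ℕ, ∫ ω, M n ω ^ 2 ∂P ≤ n * C ^ 2 := by
    intro n
    induction n with
    | zero => simp [hM]
    | succ n ih =>
      have e : ∀ ω, M (n + 1) ω ^ 2 = M n ω ^ 2 + 2 * (M n ω * D n ω) + D n ω ^ 2 := fun ω => by
        simp only [hM, Finset.sum_range_succ]
        ring
      have h2 : ∫ ω, D n ω ^ 2 ∂P ≤ C ^ 2 := by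
        have := integral_mono (hDsq n) (integrable_const (C ^ 2)) fun ω => by
          rw [← sq_abs]
          exact pow_le_pow_left₀ (abs_nonneg _) (hC n ω) 2
        simpa using this
      have hi : Integrable (fun ω => M n ω ^ 2 + 2 * (M n ω * D n ω)) P :=
        (hMsq n).add ((hMD n).const_mul 2)
      simp_rw [e]
      rw [integral_add hi (hDsq n),
        integral_add (hMsq n) ((hMD n).const_mul 2), integral_const_mul, horth n]
      push_cast
      linarith
  have hsub : ∀ᵐ ω ∂P, Tendsto (fun k : ℕ => M (k ^ 2) ω / (k ^ 2 : ℕ)) atTop (nhds 0) := by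
    have hsum : ∑' k : ℕ, ∫⁻ ω, ENNReal.ofReal ((M (k ^ 2) ω / (k ^ 2 : ℕ)) ^ 2) ∂P ≠ ⊤ := by
      have hs : Summable fun k : ℕ => C ^ 2 * (1 / (k : ℝ) ^ 2) :=
        (Real.summable_one_div_nat_pow.2 one_lt_two).mul_left _
      refine ne_top_of_le_ne_top hs.tsum_ofReal_ne_top (ENNReal.tsum_le_tsum fun k => ?_)
      have hi : Integrable (fun ω => (M (k ^ 2) ω / (k ^ 2 : ℕ)) ^ 2) P := by
        simp_rw [div_pow]
        exact (hMsq _).div_const _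
      rw [← ofReal_integral_eq_lintegral_ofReal hi (.of_forall fun ω => sq_nonneg _)]
      refine ENNReal.ofReal_le_ofReal ?_
      simp_rw [div_pow]
      rw [integral_div]
      rcases Nat.eq_zero_or_pos k with rfl | hk
      · simp
      · have hk' : (0 : ℝ) < k := by exact_mod_cast hk
        have h := hvar (k ^ 2)
        push_cast at h ⊢
        rw [div_le_iff₀ (by positivity)]
        calc _ ≤ (k : ℝ) ^ 2 * C ^ 2 := h
          _ = _ := by field_simp
    have hmeas : ∀ k : ℕ, Measurable fun ω => ENNReal.ofReal ((M (k ^ 2) ω / (k ^ 2 : ℕ)) ^ 2) :=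
      fun k => (((hMm _).div_const _).pow_const 2).ennreal_ofReal
    rw [← lintegral_tsum fun k => (hmeas k).aemeasurable] at hsum
    filter_upwards [ae_lt_top (Measurable.tsum hmeas) hsum] with ω hω
    have h0 := ENNReal.tendsto_atTop_zero_of_tsum_ne_top hω.ne
    have h1 := (ENNReal.tendsto_toReal ENNReal.zero_ne_top).comp h0
    have h2 : Tendsto (fun k : ℕ => (M (k ^ 2) ω / (k ^ 2 : ℕ)) ^ 2) atTop (nhds 0) := by
      refine h1.congr fun k => ?_
      exact ENNReal.toReal_ofReal (sq_nonneg _)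
    have h3 := (Real.continuous_sqrt.tendsto 0).comp h2
    rw [Real.sqrt_zero] at h3
    rw [tendsto_zero_iff_abs_tendsto_zero]
    exact h3.congr fun k => Real.sqrt_sq_eq_abs _
  filter_upwards [hsub] with ω hω
  have hmono : Monotone fun n : ℕ => M n ω + C * n := by
    refine monotone_nat_of_le_succ fun n => ?_
    simp only [hM, Finset.sum_range_succ]
    push_cast
    linarith [(abs_le.1 (hC n ω)).1]
  have hshift : ∀ n : ℕ, 0 < n → (M n ω + C * n) / n = M n ω / n + C := fun n hn => by
    have : (n : ℝ) ≠ 0 := by positivity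
    field_simp
  have hlim := tendsto_div_of_monotone_of_exists_subseq_tendsto_div _ C hmono fun a ha => by
    refine ⟨fun k => k ^ 2, ?_, tendsto_pow_atTop two_ne_zero, ?_⟩
    · have h1 : Tendsto (fun k : ℕ => (1 + 1 / (k : ℝ)) ^ 2) atTop (nhds ((1 + 0) ^ 2)) :=
        (tendsto_const_nhds.add tendsto_one_div_atTop_nhds_zero_nat).pow 2
      filter_upwards [h1.eventually_le_const (u := a) (by simpa using ha),
        eventually_gt_atTop 0] with k hk hk0
      have hk' : (0 : ℝ) < k := by exact_mod_cast hk0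
      have : ((k + 1 : ℕ) ^ 2 : ℝ) = (1 + 1 / (k : ℝ)) ^ 2 * k ^ 2 := by
        push_cast
        field_simp
      push_cast at this ⊢
      rw [this]
      gcongr
    · have := hω.add_const C
      rw [zero_add] at this
      refine this.congr' ?_
      filter_upwards [eventually_gt_atTop 0] with k hk
      exact (hshift (k ^ 2) (by positivity)).symm
  have := hlim.sub_const C
  rw [sub_self] at this
  refine this.congr' ?_
  filter_upwards [eventually_gt_atTop 0] with n hn
  rw [hshift n hn, add_sub_cancel_right]

/-! ### The product measure and the random walk -/

lemma IsProductNuZ.eq_infinitePi {P : Measure (ℤ → ℝ)} (hP : IsProductNuZ P) :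
    P = Measure.infinitePi fun _ => nuI := by
  refine Measure.eq_infinitePi _ fun s t ht => ?_
  have hm : Measurable fun (ω : ℤ → ℝ) (i : s) => ω i := by fun_prop
  have h := congrArg (fun μ => μ (univ.pi fun i : s => t i)) (hP.2 s)
  simp only [Measure.pi_pi] at h
  rw [Measure.map_apply hm (MeasurableSet.univ_pi fun i => ht i)] at h
  rw [← Finset.prod_coe_sort, ← h]
  congr 1
  ext ω
  simp

lemma measurable_update_prod (n : ℤ) :
    Measurable fun p : (ℤ → ℝ) × ℝ => Function.update p.1 n p.2 := by
  rw [measurable_pi_iff]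
  intro i
  by_cases hi : i = n
  · subst hi
    simpa using measurable_snd
  · simp only [Function.update_of_ne hi]
    fun_prop

/-- Resampling one coordinate does not change the product measure. -/
lemma map_update_infinitePi (n : ℤ) :
    ((Measure.infinitePi fun _ : ℤ => nuI).prod nuI).map
      (fun p : (ℤ → ℝ) × ℝ => Function.update p.1 n p.2) = Measure.infinitePi fun _ => nuI := by
  refine Measure.eq_infinitePi _ fun s t ht => ?_
  rw [Measure.map_apply (measurable_update_prod n) (MeasurableSet.pi s.countable_toSet fun i _ => ht i)]
  by_cases hn : n ∈ s
  · have e : (fun p : (ℤ → ℝ) × ℝ => Function.update p.1 n p.2) ⁻¹' (Set.pi s t) =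
        (Set.pi (s.erase n) t) ×ˢ t n := by
      ext p
      simp only [mem_preimage, Set.mem_pi, mem_prod, Finset.mem_coe, Finset.mem_erase]
      constructor
      · intro h
        refine ⟨fun i hi => ?_, by simpa using h n hn⟩
        simpa [Function.update_of_ne hi.1] using h i hi.2
      · rintro ⟨h1, h2⟩ i hi
        by_cases hin : i = n
        · subst hin
          simpa using h2
        · simpa [Function.update_of_ne hin] using h1 i ⟨hin, hi⟩
    rw [e, Measure.prod_prod, Measure.infinitePi_pi _ fun i _ => ht i, Finset.prod_erase_mul _ _ hn]
  · have e : (fun p : (ℤ → ℝ) × ℝ => Function.update p.1 n p.2) ⁻¹' (Set.pi s t) =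
        (Set.pi s t) ×ˢ univ := by
      ext p
      simp only [mem_preimage, Set.mem_pi, mem_prod, Finset.mem_coe, mem_univ, and_true]
      refine forall₂_congr fun i hi => ?_
      rw [Function.update_of_ne (ne_of_mem_of_not_mem hi hn)]
    rw [e, Measure.prod_prod, Measure.infinitePi_pi _ fun i _ => ht i, measure_univ, mul_one]

lemma integral_eq_integral_update {P : Measure (ℤ → ℝ)} (hP : IsProductNuZ P) (n : ℤ)
    {g : (ℤ → ℝ) → ℝ} (hg : Measurable g) {B : ℝ} (hB : ∀ ω, |g ω| ≤ B) :
    ∫ ω, g ω ∂P = ∫ ω, ∫ w, g (Function.update ω n w) ∂nuI ∂P := by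
  have := hP.1
  have hm := measurable_update_prod n
  have h : (P.prod nuI).map (fun p : (ℤ → ℝ) × ℝ => Function.update p.1 n p.2) = P := by
    rw [hP.eq_infinitePi]
    exact map_update_infinitePi n
  have hi : Integrable (fun p : (ℤ → ℝ) × ℝ => g (Function.update p.1 n p.2)) (P.prod nuI) :=
    integrable_of_mem_Icc (a := -B) (b := B) (hg.comp hm) fun p => abs_le.1 (hB _)
  conv_lhs => rw [← h]
  rw [integral_map hm.aemeasurable hg.aestronglyMeasurable, integral_prod _ hi]

lemma ae_forall_mem_Icc {P : Measure (ℤ → ℝ)} (hP : IsProductNuZ P) :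
    ∀ᵐ ω ∂P, ∀ n : ℤ, ω n ∈ Icc (-(1 / 2) : ℝ) (1 / 2) := by
  rw [ae_all_iff]
  intro n
  rw [hP.eq_infinitePi]
  have h := measurePreserving_eval_infinitePi (fun _ : ℤ => nuI) n
  refine h.quasiMeasurePreserving.ae (p := fun w => w ∈ Icc (-(1 / 2) : ℝ) (1 / 2)) ?_
  exact ae_restrict_mem measurableSet_Icc

lemma measurable_phiN (τ ε σ : ℝ) (n : ℕ) :
    Measurable fun p : (ℤ → ℝ) × AddCircle (1 : ℝ) => phiN τ ε σ p.1 n p.2 := by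
  induction n with
  | zero => exact measurable_snd
  | succ n ih =>
    have h : Measurable fun p : (ℤ → ℝ) × AddCircle (1 : ℝ) => (p.1 n, phiN τ ε σ p.1 n p.2) :=
      ((measurable_pi_apply (n : ℤ)).comp measurable_fst).prodMk ih
    exact (continuous_Fmap_uncurry τ ε σ).measurable.comp h

lemma phiN_update (τ ε σ : ℝ) (ω : ℤ → ℝ) {k n : ℕ} (hkn : k ≤ n) (w : ℝ)
    (x : AddCircle (1 : ℝ)) :
    phiN τ ε σ (Function.update ω n w) k x = phiN τ ε σ ω k x := by
  induction k with
  | zero => rfl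
  | succ k ih =>
    simp only [phiN, comp_apply]
    rw [ih (by omega), Function.update_of_ne (by exact_mod_cast (by omega : k ≠ n))]

lemma phiN_succ_update (τ ε σ : ℝ) (ω : ℤ → ℝ) (n : ℕ) (w : ℝ) (x : AddCircle (1 : ℝ)) :
    phiN τ ε σ (Function.update ω n w) (n + 1) x = Fmap τ ε σ w (phiN τ ε σ ω n x) := by
  simp only [phiN, comp_apply, Function.update_self]
  rw [phiN_update τ ε σ ω le_rfl]

section RandomWalk

variable {τ ε σ : ℝ} {P : Measure (ℤ → ℝ)}

/-- Along the random walk, the differences `g (X_{k+1}) - (realOp g) (X_k)` average to zero. -/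
lemma ae_tendsto_sum_sub_realOp (hP : IsProductNuZ P) {g : AddCircle (1 : ℝ) → ℝ}
    (hg : Measurable g) {a b : ℝ} (hab : ∀ x, g x ∈ Icc a b) (x : AddCircle (1 : ℝ)) :
    ∀ᵐ ω ∂P, Tendsto (fun n : ℕ => (∑ k ∈ Finset.range n,
      (g (phiN τ ε σ ω (k + 1) x) - realOp τ ε σ g (phiN τ ε σ ω k x))) / n) atTop (nhds 0) := by
  have := hP.1
  have hX : ∀ k, Measurable fun ω => phiN τ ε σ ω k x := fun k =>
    (measurable_phiN τ ε σ k).comp measurable_prodMk_right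
  have hb : ∀ y, realOp τ ε σ g y ∈ Icc a b := realOp_mem_Icc hg hab
  have hDm : ∀ k, Measurable fun ω =>
      g (phiN τ ε σ ω (k + 1) x) - realOp τ ε σ g (phiN τ ε σ ω k x) := fun k =>
    (hg.comp (hX _)).sub ((measurable_realOp τ ε σ hg).comp (hX k))
  have hC : ∀ (k : ℕ) (ω : ℤ → ℝ),
      |g (phiN τ ε σ ω (k + 1) x) - realOp τ ε σ g (phiN τ ε σ ω k x)| ≤ b - a := fun k ω => by
    rw [abs_le]
    constructor <;>
    linarith [(hab (phiN τ ε σ ω (k + 1) x)).1, (hab (phiN τ ε σ ω (k + 1) x)).2,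
      (hb (phiN τ ε σ ω k x)).1, (hb (phiN τ ε σ ω k x)).2]
  refine ae_tendsto_sum_div_of_integral_eq_zero hDm hC fun n => ?_
  have hmul : Measurable fun ω => (∑ k ∈ Finset.range n,
      (g (phiN τ ε σ ω (k + 1) x) - realOp τ ε σ g (phiN τ ε σ ω k x))) *
      (g (phiN τ ε σ ω (n + 1) x) - realOp τ ε σ g (phiN τ ε σ ω n x)) :=
    (Finset.measurable_sum _ fun k _ => hDm k).mul (hDm n)
  rw [integral_eq_integral_update hP n (B := n * (b - a) * (b - a)) hmul fun ω => ?_]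
  · refine integral_eq_zero_of_ae (.of_forall fun ω => ?_)
    have e : ∀ w, (∑ k ∈ Finset.range n,
        (g (phiN τ ε σ (Function.update ω n w) (k + 1) x) -
          realOp τ ε σ g (phiN τ ε σ (Function.update ω n w) k x))) =
        ∑ k ∈ Finset.range n, (g (phiN τ ε σ ω (k + 1) x) - realOp τ ε σ g (phiN τ ε σ ω k x)) :=
      fun w => Finset.sum_congr rfl fun k hk => by
        have hk' := Finset.mem_range.1 hk
        rw [phiN_update τ ε σ ω hk', phiN_update τ ε σ ω hk'.le]
    simp only [e, phiN_succ_update, phiN_update τ ε σ ω le_rfl, Pi.zero_apply]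
    rw [integral_const_mul, integral_sub
      (integrable_of_mem_Icc (measurable_comp_Fmap τ ε σ hg _) fun w => hab _)
      (integrable_const _)]
    simp [realOp]
  · rw [abs_mul]
    refine mul_le_mul ((Finset.abs_sum_le_sum_abs _ _).trans ?_) (hC n ω) (abs_nonneg _) ?_
    · simpa [mul_sub] using Finset.sum_le_sum fun k (_ : k ∈ Finset.range n) => hC k ω
    · exact mul_nonneg n.cast_nonneg ((abs_nonneg _).trans (hC n ω))

/-- A function differing by at most `η` from a coboundary `g - realOp g` has time averages
eventually bounded by `2 * η`. -/
lemma ae_eventually_abs_sum_div_le (hP : IsProductNuZ P) {f g : AddCircle (1 : ℝ) → ℝ}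
    (hg : Measurable g) {a b : ℝ} (hab : ∀ x, g x ∈ Icc a b) {η : ℝ} (hη : 0 < η)
    (hfg : ∀ x, |f x - (g x - realOp τ ε σ g x)| ≤ η) (x : AddCircle (1 : ℝ)) :
    ∀ᵐ ω ∂P, ∀ᶠ n : ℕ in atTop,
      |(∑ k ∈ Finset.range n, f (phiN τ ε σ ω k x)) / n| ≤ 2 * η := by
  filter_upwards [ae_tendsto_sum_sub_realOp (τ := τ) (ε := ε) (σ := σ) hP hg hab x] with ω hω
  have h1 : Tendsto (fun n : ℕ => |(∑ k ∈ Finset.range n,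
      (g (phiN τ ε σ ω (k + 1) x) - realOp τ ε σ g (phiN τ ε σ ω k x))) / n| + (b - a) / n)
      atTop (nhds (|0| + 0)) :=
    hω.abs.add (tendsto_const_nhds.div_atTop tendsto_natCast_atTop_atTop)
  rw [abs_zero, add_zero] at h1
  filter_upwards [h1.eventually_le_const hη, eventually_gt_atTop 0] with n hn hn0
  have hn' : (0 : ℝ) < n := by exact_mod_cast hn0
  have htel := Finset.sum_range_sub (fun k => g (phiN τ ε σ ω k x)) n
  have hdec : ∑ k ∈ Finset.range n, f (phiN τ ε σ ω k x) =
      ∑ k ∈ Finset.range n, (g (phiN τ ε σ ω (k + 1) x) - realOp τ ε σ g (phiN τ ε σ ω k x)) -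
      (g (phiN τ ε σ ω n x) - g (phiN τ ε σ ω 0 x)) +
      ∑ k ∈ Finset.range n, (f (phiN τ ε σ ω k x) -
        (g (phiN τ ε σ ω k x) - realOp τ ε σ g (phiN τ ε σ ω k x))) := by
    rw [← htel, ← Finset.sum_sub_distrib, ← Finset.sum_add_distrib]
    exact Finset.sum_congr rfl fun k _ => by ring
  have hr : |∑ k ∈ Finset.range n, (f (phiN τ ε σ ω k x) -
        (g (phiN τ ε σ ω k x) - realOp τ ε σ g (phiN τ ε σ ω k x)))| ≤ n * η :=
    (Finset.abs_sum_le_sum_abs _ _).trans <| by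
      simpa using Finset.sum_le_sum fun k (_ : k ∈ Finset.range n) => hfg (phiN τ ε σ ω k x)
  have hg' : |g (phiN τ ε σ ω n x) - g (phiN τ ε σ ω 0 x)| ≤ b - a := by
    rw [abs_le]
    constructor <;> linarith [(hab (phiN τ ε σ ω n x)).1, (hab (phiN τ ε σ ω n x)).2,
      (hab (phiN τ ε σ ω 0 x)).1, (hab (phiN τ ε σ ω 0 x)).2]
  rw [abs_div, abs_of_pos hn'] at hn ⊢
  rw [← add_div, div_le_iff₀ hn'] at hn
  rw [div_le_iff₀ hn', hdec]
  refine (abs_add_le _ _).trans ((add_le_add (abs_sub _ _) le_rfl).trans ?_)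
  linarith

/-- Centred bounded functions average to zero along the random walk, from every starting point. -/
lemma ae_tendsto_sum_phiN_div (hP : IsProductNuZ P) {m : Measure (AddCircle (1 : ℝ))}
    [IsProbabilityMeasure m] (hstat : IsStationaryNoisy τ ε σ m) {n : ℕ} {c : ENNReal}
    (hc0 : c ≠ 0) (hc : ∀ f : AddCircle (1 : ℝ) → ENNReal, Measurable f → ∀ x,
      c * ∫⁻ y, f y ≤ (circleOp τ ε σ)^[n] f x)
    {f : AddCircle (1 : ℝ) → ℝ} (hf : Measurable f) {a b : ℝ} (hab : ∀ x, f x ∈ Icc a b)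
    (hzero : ∫ x, f x ∂m = 0) (x : AddCircle (1 : ℝ)) :
    ∀ᵐ ω ∂P, Tendsto (fun n : ℕ => (∑ k ∈ Finset.range n, f (phiN τ ε σ ω k x)) / n)
      atTop (nhds 0) := by
  have key : ∀ j : ℕ, ∀ᵐ ω ∂P, ∀ᶠ n : ℕ in atTop,
      |(∑ k ∈ Finset.range n, f (phiN τ ε σ ω k x)) / n| ≤ 2 * (1 / ((j : ℝ) + 1)) := by
    intro j
    have hη : 0 < 1 / ((j : ℝ) + 1) := by positivity
    obtain ⟨K, hK⟩ := exists_abs_iterate_realOp_le hstat hc0 hc hf hab hzero hη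
    have hit := iterate_realOp (τ := τ) (ε := ε) (σ := σ) hf hab
    have hg : Measurable fun y => ∑ i ∈ Finset.range K, (realOp τ ε σ)^[i] f y :=
      Finset.measurable_sum _ fun i _ => (hit i).1
    refine ae_eventually_abs_sum_div_le hP hg (a := K * a) (b := K * b) (fun y => ⟨?_, ?_⟩) hη
      (fun y => ?_) x
    · simpa using Finset.sum_le_sum fun i (_ : i ∈ Finset.range K) => ((hit i).2 y).1
    · simpa using Finset.sum_le_sum fun i (_ : i ∈ Finset.range K) => ((hit i).2 y).2
    · have e : realOp τ ε σ (fun y => ∑ i ∈ Finset.range K, (realOp τ ε σ)^[i] f y) y =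
          ∑ i ∈ Finset.range K, (realOp τ ε σ)^[i + 1] f y := by
        simp only [iterate_succ_apply']
        exact integral_finsetSum _ fun i _ =>
          integrable_of_mem_Icc (measurable_comp_Fmap τ ε σ (hit i).1 y) fun w => (hit i).2 _
      have htel := Finset.sum_range_sub (fun i => (realOp τ ε σ)^[i] f y) K
      rw [e, ← Finset.sum_sub_distrib]
      rw [Finset.sum_sub_distrib] at htel ⊢
      simp only [iterate_zero, id] at htel
      convert hK y using 2
      linarith
  filter_upwards [ae_all_iff.2 key] with ω hω
  rw [Metric.tendsto_atTop']
  intro δ hδ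
  obtain ⟨j, hj⟩ := exists_nat_one_div_lt (half_pos hδ)
  obtain ⟨N, hN⟩ := eventually_atTop.1 (hω j)
  refine ⟨N, fun n hn => ?_⟩
  rw [Real.dist_0_eq_abs]
  exact (hN n hn.le).trans_lt (by linarith)

end RandomWalk

/-! ### The stationary density -/

section Density

variable {τ ε σ : ℝ} {m : Measure (AddCircle (1 : ℝ))} [IsProbabilityMeasure m]

lemma smul_volume_le_stationary (hstat : IsStationaryNoisy τ ε σ m) {n : ℕ} {c : ENNReal}
    (hc : ∀ f : AddCircle (1 : ℝ) → ENNReal, Measurable f → ∀ x,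
      c * ∫⁻ y, f y ≤ (circleOp τ ε σ)^[n] f x) : c • volume ≤ m := by
  refine Measure.le_iff.2 fun s hs => ?_
  have hf : Measurable (s.indicator (1 : AddCircle (1 : ℝ) → ENNReal)) :=
    measurable_one.indicator hs
  have h := lintegral_mono (μ := m) (hc _ hf)
  rw [lintegral_iterate_circleOp_eq hstat n hf] at h
  simpa [lintegral_indicator_one hs] using h

lemma stationary_le_smul_volume (hσ : 0 < σ) (hstat : IsStationaryNoisy τ ε σ m) :
    m ≤ ((ENNReal.ofReal σ)⁻¹ * ⌈σ⌉₊) • volume := by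
  refine Measure.le_iff.2 fun s hs => ?_
  have hf : Measurable (s.indicator (1 : AddCircle (1 : ℝ) → ENNReal)) :=
    measurable_one.indicator hs
  have h := lintegral_mono (μ := m) (circleOp_le (τ := τ) (ε := ε) hσ
    (s.indicator (1 : AddCircle (1 : ℝ) → ENNReal)))
  rw [lintegral_circleOp_eq hstat hf] at h
  simpa [lintegral_indicator_one hs] using h

end Density

/-- A measure comparable to Lebesgue measure has a density bounded away from zero and infinity. -/
lemma exists_density_mem_Icc {m : Measure (AddCircle (1 : ℝ))} [IsProbabilityMeasure m]
    {c C : ENNReal} (hc0 : c ≠ 0) (hC : C ≠ ⊤) (hcm : c • volume ≤ m) (hmC : m ≤ C • volume) :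
    ∃ (h : AddCircle (1 : ℝ) → ℝ) (a b : ℝ), 0 < a ∧ Measurable h ∧ (∀ x, h x ∈ Icc a b) ∧
      m = volume.withDensity fun x => ENNReal.ofReal (h x) := by
  have hac : m ≪ volume := Measure.absolutelyContinuous_of_le_smul hmC
  have hcC : c ≤ C := by
    simpa using (hcm.trans hmC) (univ : Set (AddCircle (1 : ℝ)))
  have hctop : c ≠ ⊤ := ne_top_of_le_ne_top hC hcC
  have hd : Measurable (m.rnDeriv volume) := Measure.measurable_rnDeriv _ _
  have hset : ∀ s, MeasurableSet s → ∫⁻ x in s, m.rnDeriv volume x = m s := fun s hs => by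
    rw [← withDensity_apply _ hs, Measure.withDensity_rnDeriv_eq _ _ hac]
  have h1 : ∀ᵐ x, c ≤ m.rnDeriv volume x :=
    ae_le_of_forall_setLIntegral_le_of_sigmaFinite measurable_const fun s hs _ => by
      rw [hset s hs, setLIntegral_const]
      exact hcm s
  have h2 : ∀ᵐ x, m.rnDeriv volume x ≤ C :=
    ae_le_of_forall_setLIntegral_le_of_sigmaFinite hd fun s hs _ => by
      rw [hset s hs, setLIntegral_const]
      exact hmC s
  refine ⟨fun x => max c.toReal (min C.toReal (m.rnDeriv volume x).toReal), c.toReal, C.toReal,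
    ENNReal.toReal_pos hc0 hctop, measurable_const.max (measurable_const.min hd.ennreal_toReal),
    fun x => ⟨le_max_left _ _, max_le (ENNReal.toReal_mono hC hcC) (min_le_left _ _)⟩, ?_⟩
  conv_lhs => rw [← Measure.withDensity_rnDeriv_eq m volume hac]
  refine withDensity_congr_ae ?_
  filter_upwards [h1, h2] with x hx1 hx2
  rw [min_eq_right (ENNReal.toReal_mono hC hx2),
    max_eq_right (ENNReal.toReal_mono (ne_top_of_le_ne_top hC hx2) hx1),
    ENNReal.ofReal_toReal (ne_top_of_le_ne_top hC hx2)]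

lemma ergodic_add_coe {t : ℝ} (ht : Irrational t) :
    Ergodic (fun y : AddCircle (1 : ℝ) => y + t) := by
  rw [AddCircle.ergodic_add_right, ← AddCircle.denseRange_zsmul_iff,
    AddCircle.denseRange_zsmul_coe_iff, div_one]
  exact ht

/-- Among almost all pairs of parameters, some pair differs by an irrational rotation. -/
lemma exists_irrational_mul_sub {σ : ℝ} (hσ : 0 < σ) {p : ℝ → Prop} (hp : ∀ᵐ w ∂nuI, p w) :
    ∃ w w', p w ∧ p w' ∧ Irrational (σ * (w' - w)) := by
  obtain ⟨w, hw⟩ := hp.exists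
  have hcount : {w' : ℝ | ¬ Irrational (σ * (w' - w))}.Countable := by
    have h : {w' : ℝ | ¬ Irrational (σ * (w' - w))} =
        (fun w' => σ * (w' - w)) ⁻¹' range ((↑) : ℚ → ℝ) := by
      ext w'
      simp [Irrational]
    rw [h]
    refine (countable_range _).preimage fun u v huv => ?_
    have := mul_left_cancel₀ hσ.ne' huv
    linarith
  have hae : ∀ᵐ w' ∂nuI, Irrational (σ * (w' - w)) :=
    (Measure.absolutelyContinuous_of_le Measure.restrict_le_self) (hcount.measure_zero volume)
  obtain ⟨w', hw', hirr⟩ := (hp.and hae).exists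
  exact ⟨w, w', hw, hw', hirr⟩

/-! ### Negativity of the Lyapunov exponent -/

section Rigidity

variable {τ ε σ : ℝ}

/-- The maps `F_w` are nonsingular. -/
lemma ae_comp_Fmap_iff (hε : 0 < ε) (hεπ : 2 * π * ε < 1) (w : ℝ)
    {p : AddCircle (1 : ℝ) → Prop} (hp : MeasurableSet {x | p x}) :
    (∀ᵐ x, p (Fmap τ ε σ w x)) ↔ ∀ᵐ y, p y := by
  have hF : Measurable (Fmap τ ε σ w) := ((continuous_Fmap_uncurry τ ε σ).comp
    (by fun_prop : Continuous fun x : AddCircle (1 : ℝ) => (w, x))).measurable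
  have h0 := lintegral_Fder_mul_comp_Fmap (τ := τ) (σ := σ) hε hεπ w
    ({x | p x}ᶜ.indicator (1 : AddCircle (1 : ℝ) → ENNReal))
  rw [lintegral_indicator_one hp.compl] at h0
  have h1 : (∀ᵐ y, p y) ↔ volume {x | p x}ᶜ = 0 := Iff.rfl
  have h2 : Measurable fun x => ENNReal.ofReal (Fder ε x) *
      {x | p x}ᶜ.indicator (1 : AddCircle (1 : ℝ) → ENNReal) (Fmap τ ε σ w x) :=
    (continuous_Fder ε).measurable.ennreal_ofReal.mul ((measurable_one.indicator hp.compl).comp hF)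
  rw [h1, ← h0, lintegral_eq_zero_iff h2]
  refine eventually_congr (.of_forall fun x => ?_)
  have := Fder_pos hε hεπ x
  simp [this]

/-- An absolutely continuous positive density cannot be preserved by almost every `F_w`. -/
lemma not_ae_density_invariant (hε : 0 < ε) (hεπ : 2 * π * ε < 1) (hσ : 0 < σ)
    {h : AddCircle (1 : ℝ) → ℝ} (hm : Measurable h) (hpos : ∀ x, 0 < h x) :
    ¬ ∀ᵐ w ∂nuI, ∀ᵐ x, h (Fmap τ ε σ w x) * Fder ε x = h x := by
  intro hinv
  obtain ⟨w, w', hw, hw', hirr⟩ := exists_irrational_mul_sub hσ hinv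
  have htrans : ∀ᵐ y : AddCircle (1 : ℝ), h (y + (σ * (w' - w) : ℝ)) = h y := by
    refine (ae_comp_Fmap_iff (τ := τ) (σ := σ) hε hεπ w
      (measurableSet_eq_fun (hm.comp (measurable_add_const _)) hm)).1 ?_
    filter_upwards [hw, hw'] with x hx hx'
    have e : Fmap τ ε σ w x + (σ * (w' - w) : ℝ) = Fmap τ ε σ w' x := by
      rw [Fmap_eq_add τ ε σ w, Fmap_eq_add τ ε σ w', add_assoc, ← AddCircle.coe_add]
      congr 2
      ring
    rw [comp_apply, e]
    exact mul_right_cancel₀ (Fder_pos hε hεπ x).ne' (hx'.trans hx.symm)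
  obtain ⟨k, hk⟩ := (ergodic_add_coe hirr).ae_eq_const_of_ae_eq_comp_ae
    hm.aestronglyMeasurable htrans
  have hF : ∀ᵐ x : AddCircle (1 : ℝ), h (Fmap τ ε σ w x) = k :=
    (ae_comp_Fmap_iff hε hεπ w (measurableSet_eq_fun hm measurable_const)).2 hk
  have hone : Fder ε =ᵐ[volume] fun _ => 1 := by
    filter_upwards [hw, hk, hF] with x hx hkx hFx
    rw [hFx, ← (show h x = k from hkx)] at hx
    exact mul_left_cancel₀ (hpos x).ne' (by rw [hx, mul_one])
  have hone' := (continuous_Fder ε).ae_eq_iff_eq volume continuous_const |>.1 hone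
  have h0 := congrFun hone' ((0 : ℝ) : AddCircle (1 : ℝ))
  rw [Fder_coe] at h0
  simp at h0
  linarith [hε, h0]

end Rigidity

/-- The Lyapunov exponent of a stationary measure equivalent to Lebesgue measure is negative. -/
lemma integral_log_Fder_neg {τ ε σ : ℝ} (hε : 0 < ε) (hεπ : 2 * π * ε < 1) (hσ : 0 < σ)
    {m : Measure (AddCircle (1 : ℝ))} [IsProbabilityMeasure m] (hstat : IsStationaryNoisy τ ε σ m)
    {h : AddCircle (1 : ℝ) → ℝ} {a b : ℝ} (ha : 0 < a) (hm : Measurable h)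
    (hab : ∀ x, h x ∈ Icc a b) (hdens : m = volume.withDensity fun x => ENNReal.ofReal (h x)) :
    ∫ x, Real.log (Fder ε x) ∂m < 0 := by
  have hpos : ∀ x, 0 < h x := fun x => ha.trans_le (hab x).1
  have hFm : Measurable fun p : AddCircle (1 : ℝ) × ℝ => Fmap τ ε σ p.2 p.1 :=
    (continuous_Fmap_uncurry τ ε σ).measurable.comp measurable_swap
  have hDm : Measurable (Fder ε) := (continuous_Fder ε).measurable
  have hD0 := Fder_pos hε hεπ
  set T : AddCircle (1 : ℝ) × ℝ → ℝ :=
    fun p => h (Fmap τ ε σ p.2 p.1) * Fder ε p.1 / h p.1 with hT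
  have hTm : Measurable T :=
    ((hm.comp hFm).mul (hDm.comp measurable_fst)).div (hm.comp measurable_fst)
  have hTpos : ∀ p, 0 < T p := fun p => div_pos (mul_pos (hpos _) (hD0 _)) (hpos _)
  have hTint : Integrable T (m.prod nuI) :=
    integrable_of_mem_Icc hTm (a := 0) (b := b * 2 / a) fun p => by
      refine ⟨(hTpos p).le, ?_⟩
      have h1 := (hab (Fmap τ ε σ p.2 p.1)).2
      have h2 := (hab p.1).1
      have h3 := Fder_le_two hε hεπ p.1
      have h4 := (hpos (Fmap τ ε σ p.2 p.1)).le
      have h5 := (hD0 p.1).le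
      exact div_le_div₀ (mul_nonneg (h4.trans h1) zero_le_two)
        (mul_le_mul h1 h3 h5 (h4.trans h1)) ha h2
  have hone : ∫ p, T p ∂(m.prod nuI) = 1 := by
    have hinner : ∀ w, ∫⁻ x, ENNReal.ofReal (T (x, w)) ∂m = 1 := by
      intro w
      have hTw : Measurable fun x => ENNReal.ofReal (T (x, w)) :=
        (hTm.comp measurable_prodMk_right).ennreal_ofReal
      have huniv : ∫⁻ x, ENNReal.ofReal (h x) = 1 := by
        rw [← setLIntegral_univ, ← withDensity_apply _ MeasurableSet.univ, ← hdens, measure_univ]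
      rw [hdens, lintegral_withDensity_eq_lintegral_mul _ hm.ennreal_ofReal hTw, ← huniv,
        ← lintegral_Fder_mul_comp_Fmap (τ := τ) (σ := σ) hε hεπ w fun x => ENNReal.ofReal (h x)]
      refine lintegral_congr fun x => ?_
      rw [Pi.mul_apply, ← ENNReal.ofReal_mul (hpos x).le, ← ENNReal.ofReal_mul (hD0 x).le]
      congr 1
      have := (hpos x).ne'
      simp only [hT]
      field_simp
    rw [integral_eq_lintegral_of_nonneg_ae (.of_forall fun p => (hTpos p).le)
      hTm.aestronglyMeasurable, lintegral_prod_symm _ hTm.ennreal_ofReal.aemeasurable]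
    simp [hinner]
  have hlogh : ∀ x, Real.log (h x) ∈ Icc (Real.log a) (Real.log b) := fun x =>
    ⟨Real.log_le_log ha (hab x).1, Real.log_le_log (hpos x) (hab x).2⟩
  have hlogD : ∀ x, Real.log (Fder ε x) ∈ Icc (Real.log (1 - 2 * π * ε)) (Real.log 2) := fun x =>
    ⟨Real.log_le_log (by linarith) (one_sub_le_Fder hε x),
      Real.log_le_log (hD0 x) (Fder_le_two hε hεπ x)⟩
  have hloghm : Measurable fun x => Real.log (h x) := Real.measurable_log.comp hm
  have hlogDm : Measurable fun x => Real.log (Fder ε x) := Real.measurable_log.comp hDm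
  have hlogT : ∀ p, Real.log (T p) =
      Real.log (h (Fmap τ ε σ p.2 p.1)) + (Real.log (Fder ε p.1) - Real.log (h p.1)) := fun p => by
    simp only [hT]
    rw [Real.log_div (mul_pos (hpos _) (hD0 _)).ne' (hpos _).ne',
      Real.log_mul (hpos _).ne' (hD0 _).ne', add_sub_assoc]
  have hi1 : Integrable (fun p : AddCircle (1 : ℝ) × ℝ => Real.log (h (Fmap τ ε σ p.2 p.1)))
      (m.prod nuI) := integrable_of_mem_Icc (hloghm.comp hFm) fun p => hlogh _
  have hiD : Integrable (fun x => Real.log (Fder ε x)) m := integrable_of_mem_Icc hlogDm hlogD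
  have hih : Integrable (fun x => Real.log (h x)) m := integrable_of_mem_Icc hloghm hlogh
  have hi2 : Integrable (fun p : AddCircle (1 : ℝ) × ℝ =>
      Real.log (Fder ε p.1) - Real.log (h p.1)) (m.prod nuI) := (hiD.sub hih).comp_fst nuI
  have hlogTint : Integrable (fun p => Real.log (T p)) (m.prod nuI) := by
    simp_rw [hlogT]
    exact hi1.add hi2
  have hlam : ∫ p, Real.log (T p) ∂(m.prod nuI) = ∫ x, Real.log (Fder ε x) ∂m := by
    have hst := integral_iterate_realOp (τ := τ) (ε := ε) (σ := σ) hstat hloghm hlogh 1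
    simp_rw [hlogT]
    rw [integral_add hi1 hi2, integral_prod _ hi1, integral_prod _ hi2]
    simp only [integral_const, probReal_univ, one_smul]
    rw [integral_sub hiD hih, ← hst]
    simp only [iterate_one, realOp]
    ring
  by_contra! hneg
  have hnn : ∀ p, 0 ≤ T p - 1 - Real.log (T p) := fun p => by
    linarith [Real.log_le_sub_one_of_pos (hTpos p)]
  have hdiff : Integrable (fun p => T p - 1 - Real.log (T p)) (m.prod nuI) :=
    (hTint.sub (integrable_const 1)).sub hlogTint
  have hzero : ∫ p, (T p - 1 - Real.log (T p)) ∂(m.prod nuI) = 0 := by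
    refine le_antisymm ?_ (integral_nonneg hnn)
    have hT1 : Integrable (fun p => T p - 1) (m.prod nuI) := hTint.sub (integrable_const 1)
    rw [integral_sub hT1 hlogTint, integral_sub hTint (integrable_const 1), hone, hlam]
    simpa using hneg
  have hae : ∀ᵐ p ∂(m.prod nuI), T p = 1 := by
    filter_upwards [(integral_eq_zero_iff_of_nonneg hnn hdiff).1 hzero] with p hp
    by_contra hne
    have := Real.log_lt_sub_one_of_pos (hTpos p) hne
    simp only [Pi.zero_apply] at hp
    linarith
  have hvol : volume ≪ m := by
    rw [hdens]
    exact withDensity_absolutelyContinuous' hm.ennreal_ofReal.aemeasurable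
      (.of_forall fun x => by simpa using hpos x)
  refine not_ae_density_invariant (τ := τ) hε hεπ hσ hm hpos ?_
  have hswap := (Measure.ae_ae_comm (μ := m) (ν := nuI) (p := fun x w => T (x, w) = 1)
    (measurableSet_eq_fun hTm measurable_const)).1 (Measure.ae_ae_of_ae_prod hae)
  filter_upwards [hswap] with w hw
  filter_upwards [hvol.ae_le hw] with x hx
  simpa only [one_mul] using (div_eq_iff (hpos x).ne').1 hx

/-- **Irrational rotation number forces a negative Lyapunov exponent:** if the random
rotation number `ρ` is irrational, then there is `λ < 0` such that for `P`-a.e. `ω` and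
`m`-a.e. `x`, `(1/n) Σ_{k<n} log F'(φ(k,ω)(x)) → λ < 0`. -/
theorem noisy_circle_map_negative_lyapunov (τ ε σ : ℝ)
    (hε : 0 < ε) (hεπ : 2 * π * ε < 1) (hσ : 0 < σ)
    (P : Measure (ℤ → ℝ)) (hP : IsProductNuZ P)
    (m : Measure (AddCircle (1:ℝ)))
    (hprob : IsProbabilityMeasure m) (hstat : IsStationaryNoisy τ ε σ m)
    (ρ : ℝ)
    (hρ : ∀ᵐ ω ∂P, ∀ x : ℝ,
      Tendsto (fun n : ℕ => (Gn τ ε σ ω n x - x) / n) atTop (nhds ρ))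
    (hirr : Irrational ρ) :
    ∃ lam : ℝ, lam < 0 ∧ ∀ᵐ ω ∂P, ∀ᵐ x ∂m,
      Tendsto
        (fun n : ℕ =>
          (1 / (n : ℝ)) * ∑ k ∈ Finset.range n, Real.log (Fder ε (phiN τ ε σ ω k x)))
        atTop (nhds lam) := by
  have hPp := hP.1
  obtain ⟨ω₀, hω₀, hrot⟩ := ((ae_forall_mem_Icc hP).and hρ).exists
  obtain ⟨n, c, hc0, hc⟩ := exists_doeblin hε hεπ hσ hirr (fun n => hω₀ n) (hrot 0)
  have hC : (ENNReal.ofReal σ)⁻¹ * (⌈σ⌉₊ : ENNReal) ≠ ⊤ :=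
    ENNReal.mul_ne_top (by simpa using hσ) (ENNReal.natCast_ne_top _)
  obtain ⟨h, a, b, ha, hm, hab, hdens⟩ := exists_density_mem_Icc hc0 hC
    (smul_volume_le_stationary hstat hc) (stationary_le_smul_volume hσ hstat)
  refine ⟨∫ x, Real.log (Fder ε x) ∂m, integral_log_Fder_neg hε hεπ hσ hstat ha hm hab hdens, ?_⟩
  set lam := ∫ x, Real.log (Fder ε x) ∂m
  have hlogm : Measurable fun x => Real.log (Fder ε x) :=
    Real.measurable_log.comp (continuous_Fder ε).measurable
  have hlog : ∀ x, Real.log (Fder ε x) ∈ Icc (Real.log (1 - 2 * π * ε)) (Real.log 2) := fun x =>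
    ⟨Real.log_le_log (by linarith) (one_sub_le_Fder hε x),
      Real.log_le_log (Fder_pos hε hεπ x) (Fder_le_two hε hεπ x)⟩
  have hzero : ∫ x, (Real.log (Fder ε x) - lam) ∂m = 0 := by
    rw [integral_sub (integrable_of_mem_Icc hlogm hlog) (integrable_const _)]
    simp [lam]
  have hx : ∀ x, ∀ᵐ ω ∂P, Tendsto (fun n : ℕ => (1 / (n : ℝ)) *
      ∑ k ∈ Finset.range n, Real.log (Fder ε (phiN τ ε σ ω k x))) atTop (nhds lam) := by
    intro x
    filter_upwards [ae_tendsto_sum_phiN_div hP hstat hc0 hc (hlogm.sub_const lam)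
      (fun x => ⟨sub_le_sub_right (hlog x).1 lam, sub_le_sub_right (hlog x).2 lam⟩) hzero x]
      with ω hω
    have h1 := hω.add_const lam
    rw [zero_add] at h1
    refine h1.congr' ?_
    filter_upwards [eventually_gt_atTop 0] with n hn
    have hn' : (n : ℝ) ≠ 0 := by positivity
    rw [Finset.sum_sub_distrib, Finset.sum_const, Finset.card_range, nsmul_eq_mul]
    field_simp
    ring
  refine (Measure.ae_ae_comm ?_).2 (.of_forall hx)
  refine measurableSet_tendsto _ fun n => ?_
  exact measurable_const.mul
    (Finset.measurable_sum _ fun k _ => hlogm.comp (measurable_phiN τ ε σ k))
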